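/- Let (R, m) be a commutative noetherian local ring, let M be a finitely generated R-module of Krull dimension d, and let r be a non-negative integer with r < d. Let L^r(M) be the set of ideals b of R such that H^i_b(M) is not artinian for some i ≥ r; then L^r(M) is non-empty, and for each element q of L^r(M) that is maximal with respect to inclusion: (i) the Bass numbers μ^j(H^i_q(M)) = dim_{R/m} Ext^j_R(R/m, H^i_q(M)) are finite for all j ≥ 0 and all i ≥ r; and (ii) q is a prime ideal. -/

import Mathlib

open CategoryTheory

/-- The Krull dimension of an `R`-module `Y`, i.e. the Krull dimension of its support in
`Spec R`. -/
noncomputable def moduleDim (R : Type) [CommRing R] (Y : Type) [AddCommGroup Y] [Module R Y] :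
    WithBot ℕ∞ :=
  Order.krullDim (Module.support R Y)

namespace S19
open CategoryTheory.Limits

section T0
variable {R : Type} [CommRing R]

/-- cochain complex computing old Ext -/
noncomputable abbrev KK {X : ModuleCat.{0} R} (P : ProjectiveResolution X) (Y : ModuleCat.{0} R) :
    CochainComplex (ModuleCat.{0} R) ℕ := P.complex.linearYonedaObj R Y

noncomputable abbrev OExt (X Y : ModuleCat.{0} R) (n : ℕ) : ModuleCat.{0} R :=
  ((Ext R (ModuleCat R) n).obj (Opposite.op X)).obj Y

noncomputable abbrev ZZ {X : ModuleCat.{0} R} (P : ProjectiveResolution X) (Y : ModuleCat.{0} R)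
    (n : ℕ) : Submodule R ((KK P Y).X n) := LinearMap.ker ((KK P Y).sc n).g.hom

noncomputable def oldMk {X : ModuleCat.{0} R} (P : ProjectiveResolution X) (Y : ModuleCat.{0} R)
    (n : ℕ) : ZZ P Y n →ₗ[R] OExt X Y n :=
  (P.isoExt n Y (R := R)).inv.hom ∘ₗ ((KK P Y).sc n).homologyπ.hom ∘ₗ
    ((KK P Y).sc n).moduleCatCyclesIso.inv.hom

lemma oldMk_surj {X : ModuleCat.{0} R} (P : ProjectiveResolution X) (Y : ModuleCat.{0} R)
    (n : ℕ) : Function.Surjective (oldMk P Y n) := by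
  rw [oldMk]
  have h1 : Function.Surjective (P.isoExt n Y (R := R)).inv.hom :=
    (ModuleCat.epi_iff_surjective _).1 inferInstance
  have h2 : Function.Surjective ((KK P Y).sc n).homologyπ.hom :=
    (ModuleCat.epi_iff_surjective _).1 inferInstance
  have h3 : Function.Surjective ((KK P Y).sc n).moduleCatCyclesIso.inv.hom :=
    (ModuleCat.epi_iff_surjective _).1 inferInstance
  exact h1.comp (h2.comp h3)

lemma oldMk_eq_zero {X : ModuleCat.{0} R} (P : ProjectiveResolution X) (Y : ModuleCat.{0} R)
    (n : ℕ) (z : ZZ P Y n) : oldMk P Y n z = 0 ↔ ∃ w, ((KK P Y).sc n).f.hom w = z.1 := by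
  have h1 : Function.Injective (P.isoExt n Y (R := R)).inv.hom :=
    (ModuleCat.mono_iff_injective _).1 inferInstance
  have h2 : Function.Injective ((KK P Y).sc n).moduleCatHomologyIso.inv.hom :=
    (ModuleCat.mono_iff_injective _).1 inferInstance
  have h3 := ((KK P Y).sc n).moduleCatCyclesIso_inv_π
  have h4 : oldMk P Y n z = (P.isoExt n Y (R := R)).inv.hom
      (((KK P Y).sc n).moduleCatHomologyIso.inv.hom (Submodule.mkQ _ z)) := by
    have := congrArg (fun f => f.hom z) h3
    simp only [oldMk, LinearMap.comp_apply]
    congr 1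
  rw [h4]
  refine Iff.trans ((injective_iff_map_eq_zero' _).1 h1 _) ?_
  refine Iff.trans ((injective_iff_map_eq_zero' _).1 h2 _) ?_
  refine Iff.trans (Submodule.Quotient.mk_eq_zero _) ?_
  constructor
  · rintro ⟨w, hw⟩
    exact ⟨w, congrArg Subtype.val hw⟩
  · rintro ⟨w, hw⟩
    exact ⟨w, Subtype.ext hw⟩

/-- identification of the terms -/
noncomputable def toH {X : ModuleCat.{0} R} (P : ProjectiveResolution X) (Y : ModuleCat.{0} R)
    (n : ℕ) : (KK P Y).X n →ₗ[R] (P.complex.X n ⟶ Y) := LinearMap.id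

noncomputable def ofH {X : ModuleCat.{0} R} (P : ProjectiveResolution X) (Y : ModuleCat.{0} R)
    (n : ℕ) : (P.complex.X n ⟶ Y) →ₗ[R] (KK P Y).X n := LinearMap.id

lemma mem_ZZ {X : ModuleCat.{0} R} (P : ProjectiveResolution X) (Y : ModuleCat.{0} R)
    (n : ℕ) (z : (KK P Y).X n) : z ∈ ZZ P Y n ↔ P.complex.d (n+1) n ≫ toH P Y n z = 0 := by
  refine Iff.trans LinearMap.mem_ker ?_
  have : (ComplexShape.up ℕ).next n = n + 1 := by simp
  have key : ∀ m, m = n + 1 → (((KK P Y).d n m).hom z = 0 ↔ P.complex.d (n+1) n ≫ toH P Y n z = 0) := by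
    rintro m rfl
    exact Iff.rfl
  exact key _ this

noncomputable def newMk {X : ModuleCat.{0} R} (P : ProjectiveResolution X) (Y : ModuleCat.{0} R)
    (n : ℕ) : ZZ P Y n →ₗ[R] Abelian.Ext X Y n where
  toFun z := P.extMk (toH P Y n z.1) (n+1) rfl ((mem_ZZ P Y n _).1 z.2)
  map_add' a b := (P.add_extMk _ _ _ _ _ _).symm
  map_smul' r a := by
    rw [Abelian.Ext.smul_eq_comp_mk₀]
    rw [P.extMk_comp_mk₀]
    congr 1

lemma newMk_surj {X : ModuleCat.{0} R} (P : ProjectiveResolution X) (Y : ModuleCat.{0} R)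
    (n : ℕ) : Function.Surjective (newMk P Y n) := by
  intro a
  obtain ⟨f, hf, rfl⟩ := P.extMk_surjective a (n+1) rfl
  exact ⟨⟨ofH P Y n f, (mem_ZZ P Y n _).2 hf⟩, rfl⟩

open CochainComplex.HomComplex in
lemma extMk_eq_zero_zero {C : Type*} [Category C] [Abelian C] [HasExt C] {X Y : C}
    (P : ProjectiveResolution X) (f : P.complex.X 0 ⟶ Y) (m : ℕ) (hm : 0 + 1 = m)
    (hf : P.complex.d m 0 ≫ f = 0) : P.extMk f m hm hf = 0 ↔ f = 0 := by
  constructor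
  · intro h
    have h2 := h
    simp only [← P.extEquivCohomologyClass.apply_eq_iff_eq,
      ProjectiveResolution.extEquivCohomologyClass_extMk, ProjectiveResolution.extEquivCohomologyClass_zero,
      CohomologyClass.mk_eq_zero_iff] at h2
    rw [Cocycle.toSingleMk_mem_coboundaries_iff _ _ _ _ _ (1) (by lia)] at h2
    obtain ⟨g, hg⟩ := h2
    have hz : IsZero (P.cochainComplex.X 1) := P.cochainComplex.isZero_of_isStrictlyLE 0 1 (by lia)
    rw [hz.eq_of_src g 0, comp_zero] at hg
    rw [← cancel_epi (P.cochainComplexXIso (-(0:ℕ)) 0 rfl).hom, comp_zero]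
    exact hg.symm
  · rintro rfl
    simp

lemma newMk_eq_zero {X : ModuleCat.{0} R} (P : ProjectiveResolution X) (Y : ModuleCat.{0} R)
    (n : ℕ) (z : ZZ P Y n) : newMk P Y n z = 0 ↔ ∃ w, ((KK P Y).sc n).f.hom w = z.1 := by
  change P.extMk (toH P Y n z.1) (n+1) rfl ((mem_ZZ P Y n _).1 z.2) = 0 ↔ _
  cases n with
  | zero =>
    rw [extMk_eq_zero_zero]
    have : ((KK P Y).sc 0).f = 0 := by
      apply (KK P Y).shape
      simp
    rw [this]
    constructor
    · intro h
      exact ⟨0, h.symm⟩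
    · rintro ⟨w, hw⟩
      exact hw.symm
  | succ n =>
    rw [P.extMk_eq_zero_iff _ _ _ _ n rfl]
    have : (ComplexShape.up ℕ).prev (n+1) = n := by simp
    have key : ∀ m, m = n → ((∃ g, P.complex.d (n+1) n ≫ g = toH P Y (n+1) z.1) ↔ 
       ∃ w, ((KK P Y).d m (n+1)).hom w = z.1) := by
      rintro m rfl
      exact Iff.rfl
    exact key _ this


noncomputable def KKmap {X X' : ModuleCat.{0} R} {P : ProjectiveResolution X}
    {P' : ProjectiveResolution X'} (φ : P'.complex ⟶ P.complex) (Y : ModuleCat.{0} R) :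
    KK P Y ⟶ KK P' Y :=
  (HomologicalComplex.unopFunctor (ModuleCat.{0} R) (ComplexShape.down ℕ)).map
    (((((linearYoneda R (ModuleCat R)).obj Y).rightOp.mapHomologicalComplex _).map φ).op)

lemma isoExt_nat {X X' : ModuleCat.{0} R} {P : ProjectiveResolution X}
    {P' : ProjectiveResolution X'} {g : X' ⟶ X} (φ : ProjectiveResolution.Hom P' P g)
    (Y : ModuleCat.{0} R) (n : ℕ) :
    (P.isoExt n Y (R := R)).inv ≫ ((Ext R (ModuleCat R) n).map g.op).app Y =
      HomologicalComplex.homologyMap (KKmap φ.hom Y) n ≫ (P'.isoExt n Y (R := R)).inv := by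
  have h1 := ProjectiveResolution.isoLeftDerivedObj_hom_naturality g P' P φ.hom
    φ.hom_f_zero_comp_π_f_zero ((linearYoneda R (ModuleCat R)).obj Y).rightOp n
  have h2 := HomologicalComplex.homologyOp_hom_naturality (KKmap φ.hom Y) n
  have h1' := congrArg Quiver.Hom.unop h1
  have h2' := congrArg Quiver.Hom.unop h2
  dsimp only [ProjectiveResolution.isoExt, Iso.trans_inv, Iso.symm_inv, Category.assoc]
  refine (Category.assoc _ _ _).trans ?_
  refine (congrArg (fun z => (HomologicalComplex.homologyUnop _ n).hom ≫ z) h1').trans ?_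
  refine (Category.assoc _ _ _).symm.trans ?_
  refine Eq.trans ?_ (Category.assoc _ _ _)
  refine congrArg (fun z => z ≫ _) ?_
  exact h2'

lemma oldMk_nat {X X' : ModuleCat.{0} R} {P : ProjectiveResolution X}
    {P' : ProjectiveResolution X'} {g : X' ⟶ X} (φ : ProjectiveResolution.Hom P' P g)
    (Y : ModuleCat.{0} R) (n : ℕ) (z : ZZ P Y n) (z' : ZZ P' Y n)
    (h : toH P' Y n z'.1 = φ.hom.f n ≫ toH P Y n z.1) :
    (((Ext R (ModuleCat R) n).map g.op).app Y).hom (oldMk P Y n z) = oldMk P' Y n z' := by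
  have h1 := congrArg (fun f => f.hom (((KK P Y).sc n).homologyπ.hom
    (((KK P Y).sc n).moduleCatCyclesIso.inv.hom z))) (isoExt_nat φ Y n)
  refine Eq.trans h1 ?_
  refine congrArg (P'.isoExt n Y (R := R)).inv.hom ?_
  have h2 := congrArg (fun f => f.hom (((KK P Y).sc n).moduleCatCyclesIso.inv.hom z))
    (HomologicalComplex.homologyπ_naturality (KKmap φ.hom Y) n)
  refine Eq.trans h2 ?_
  refine congrArg (((KK P' Y).sc n).homologyπ).hom ?_
  have inj : Function.Injective ((KK P' Y).iCycles n).hom :=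
    (ModuleCat.mono_iff_injective _).1 inferInstance
  apply inj
  have h3 := congrArg (fun f => f.hom (((KK P Y).sc n).moduleCatCyclesIso.inv.hom z))
    (HomologicalComplex.cyclesMap_i (KKmap φ.hom Y) n)
  refine Eq.trans h3 ?_
  have h4 := congrArg (fun f => f.hom z) ((KK P Y).sc n).moduleCatCyclesIso_inv_iCycles
  have h5 := congrArg (fun f => f.hom z') ((KK P' Y).sc n).moduleCatCyclesIso_inv_iCycles
  refine Eq.trans ?_ h5.symm
  refine (congrArg ((KKmap φ.hom Y).f n).hom h4).trans ?_
  exact h.symm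

/-- The canonical comparison. -/
noncomputable def extCmp (X Y : ModuleCat.{0} R) (n : ℕ) :
    OExt X Y n ≃ₗ[R] Abelian.Ext X Y n :=
  let P := projectiveResolution X
  ((oldMk P Y n).quotKerEquivOfSurjective (oldMk_surj P Y n)).symm ≪≫ₗ
   (Submodule.quotEquivOfEq _ _ (by
      ext z
      rw [LinearMap.mem_ker, LinearMap.mem_ker]
      exact (oldMk_eq_zero P Y n z).trans (newMk_eq_zero P Y n z).symm)) ≪≫ₗ
  ((newMk P Y n).quotKerEquivOfSurjective (newMk_surj P Y n))

lemma extCmp_oldMk (X Y : ModuleCat.{0} R) (n : ℕ) (z : ZZ (projectiveResolution X) Y n) :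
    extCmp X Y n (oldMk (projectiveResolution X) Y n z) = newMk (projectiveResolution X) Y n z := by
  simp only [extCmp, LinearEquiv.trans_apply]
  have : ((oldMk (projectiveResolution X) Y n).quotKerEquivOfSurjective
      (oldMk_surj (projectiveResolution X) Y n)).symm (oldMk (projectiveResolution X) Y n z) =
      Submodule.Quotient.mk z := by
    rw [LinearEquiv.symm_apply_eq]
    rfl
  rw [this]
  rfl

lemma exists_hom {X X' : ModuleCat.{0} R} (g : X' ⟶ X) (P' : ProjectiveResolution X')
    (P : ProjectiveResolution X) : Nonempty (ProjectiveResolution.Hom P' P g) :=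
  ⟨⟨ProjectiveResolution.lift g P' P, by
    have := congrArg (fun f => f.f 0) (ProjectiveResolution.lift_commutes g P' P)
    exact this⟩⟩

lemma extCmp_nat {X X' : ModuleCat.{0} R} (g : X' ⟶ X) (Y : ModuleCat.{0} R) (n : ℕ)
    (e : OExt X Y n) :
    extCmp X' Y n ((((Ext R (ModuleCat R) n).map g.op).app Y).hom e) =
      (Abelian.Ext.mk₀ g).comp (extCmp X Y n e) (zero_add n) := by
  obtain ⟨z, rfl⟩ := oldMk_surj (projectiveResolution X) Y n e
  obtain ⟨φ⟩ := exists_hom g (projectiveResolution X') (projectiveResolution X)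
  have hz : ofH (projectiveResolution X') Y n (φ.hom.f n ≫ toH (projectiveResolution X) Y n z.1)
      ∈ ZZ (projectiveResolution X') Y n := by
    rw [mem_ZZ]
    have := (mem_ZZ _ _ _ _).1 z.2
    change _ ≫ φ.hom.f n ≫ toH (projectiveResolution X) Y n z.1 = 0
    rw [← φ.hom.comm_assoc, this, comp_zero]
  refine (congrArg (extCmp X' Y n) (oldMk_nat φ Y n z ⟨_, hz⟩ rfl)).trans ?_
  rw [extCmp_oldMk, extCmp_oldMk]
  exact (ProjectiveResolution.mk₀_comp_extMk _ _ rfl ((mem_ZZ _ _ _ _).1 z.2) φ).symm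

end T0
end S19

namespace S19
open CategoryTheory.Limits

section T1
variable {R : Type} [CommRing R]

noncomputable abbrev Qm (b : Ideal R) (n : ℕ) : ModuleCat.{0} R := ModuleCat.of R (R ⧸ b ^ n)

noncomputable def Qpr (b : Ideal R) {n m : ℕ} (h : n ≤ m) : Qm b m ⟶ Qm b n :=
  ModuleCat.ofHom <| Submodule.mapQ _ _ LinearMap.id (Ideal.pow_le_pow_right h)

lemma Qpr_refl (b : Ideal R) (n : ℕ) : Qpr b (le_refl n) = 𝟙 _ := by
  ext
  rfl

lemma Qpr_trans (b : Ideal R) {n m k : ℕ} (h : n ≤ m) (h' : m ≤ k) :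
    Qpr b h' ≫ Qpr b h = Qpr b (h.trans h') := by
  ext
  rfl

noncomputable abbrev EE (b : Ideal R) (i : ℕ) (M : ModuleCat.{0} R) (n : ℕ) : Type :=
  Abelian.Ext (Qm b n) M i

noncomputable def tr (b : Ideal R) (i : ℕ) (M : ModuleCat.{0} R) (n m : ℕ) (h : n ≤ m) :
    EE b i M n →ₗ[R] EE b i M m :=
  (Abelian.Ext.mk₀ (Qpr b h)).precompOfLinear R M (zero_add i)

lemma tr_apply (b : Ideal R) (i : ℕ) (M : ModuleCat.{0} R) (n m : ℕ) (h : n ≤ m)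
    (e : EE b i M n) : tr b i M n m h e = (Abelian.Ext.mk₀ (Qpr b h)).comp e (zero_add i) := rfl

instance (b : Ideal R) (i : ℕ) (M : ModuleCat.{0} R) :
    DirectedSystem (EE b i M) (fun n m h => tr b i M n m h) where
  map_self n x := by
    simp only [tr_apply, Qpr_refl, Abelian.Ext.mk₀_id_comp]
  map_map n m k h h' x := by
    simp only [tr_apply]
    rw [Abelian.Ext.mk₀_comp_mk₀_assoc, Qpr_trans]

/-- Local cohomology as a direct limit of new Ext. -/
noncomputable abbrev DD (b : Ideal R) (i : ℕ) (M : ModuleCat.{0} R) : Type :=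
  Module.DirectLimit (EE b i M) (tr b i M)

noncomputable abbrev io (b : Ideal R) (i : ℕ) (M : ModuleCat.{0} R) (n : ℕ) :
    EE b i M n →ₗ[R] DD b i M := Module.DirectLimit.of R ℕ (EE b i M) (tr b i M) n

lemma io_surj {b : Ideal R} {i : ℕ} {M : ModuleCat.{0} R} (z : DD b i M) :
    ∃ n e, io b i M n e = z := Module.DirectLimit.exists_of z

lemma io_zero {b : Ideal R} {i : ℕ} {M : ModuleCat.{0} R} {n : ℕ} {e : EE b i M n}
    (h : io b i M n e = 0) : ∃ m, ∃ h : n ≤ m, tr b i M n m h e = 0 :=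
  Module.DirectLimit.of.zero_exact h

lemma io_tr {b : Ideal R} {i : ℕ} {M : ModuleCat.{0} R} {n m : ℕ} (h : n ≤ m) (e : EE b i M n) :
    io b i M m (tr b i M n m h e) = io b i M n e := Module.DirectLimit.of_f

noncomputable abbrev LCD (b : Ideal R) (i : ℕ) (M : ModuleCat.{0} R) : ℕᵒᵖᵒᵖ ⥤ ModuleCat.{0} R :=
  localCohomology.diagram (localCohomology.idealPowersDiagram b) i ⋙ (evaluation _ _).obj M

lemma exists_lc_cocone (b : Ideal R) (i : ℕ) (M : ModuleCat.{0} R) :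
    ∃ c : Cocone (LCD b i M), Nonempty (IsColimit c) ∧ c.pt = (localCohomology b i).obj M := by
  have := localCohomology.hasColimitDiagram.{0,0} (localCohomology.idealPowersDiagram b) i
  let c := ((evaluation _ _).obj M).mapCocone
    (colimit.cocone (localCohomology.diagram (localCohomology.idealPowersDiagram b) i))
  refine ⟨c, ⟨isColimitOfPreserves _ (colimit.isColimit _)⟩, rfl⟩

instance : IsFiltered ℕᵒᵖᵒᵖ := inferInstance

noncomputable def cmpL (b : Ideal R) (i : ℕ) (M : ModuleCat.{0} R) (n : ℕ) :
    (LCD b i M).obj (Opposite.op (Opposite.op n)) ≃ₗ[R] EE b i M n := extCmp (Qm b n) M i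

lemma cmpL_nat (b : Ideal R) (i : ℕ) (M : ModuleCat.{0} R) (n m : ℕ) (h : n ≤ m)
    (f : Opposite.op (Opposite.op n) ⟶ Opposite.op (Opposite.op m))
    (y : (LCD b i M).obj (Opposite.op (Opposite.op n))) :
    cmpL b i M m (((LCD b i M).map f).hom y) = tr b i M n m h (cmpL b i M n y) := by
  rw [tr_apply]
  exact extCmp_nat (Qpr b h) M i y

theorem lc_equiv (b : Ideal R) (i : ℕ) (M : ModuleCat.{0} R) :
    Nonempty ((localCohomology b i).obj M ≃ₗ[R] DD b i M) := by
  obtain ⟨c, ⟨hc⟩, hpt⟩ := exists_lc_cocone b i M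
  rw [← hpt]
  let g : ∀ n, EE b i M n →ₗ[R] c.pt := fun n =>
    (c.ι.app (Opposite.op (Opposite.op n))).hom ∘ₗ (cmpL b i M n).symm.toLinearMap
  have key : ∀ n m (h : n ≤ m) (x : EE b i M n), (cmpL b i M m).symm (tr b i M n m h x) =
      ((LCD b i M).map (homOfLE h).op.op).hom ((cmpL b i M n).symm x) := by
    intro n m h x
    rw [LinearEquiv.symm_apply_eq, cmpL_nat b i M n m h, LinearEquiv.apply_symm_apply]
  have hg : ∀ n m h x, g m (tr b i M n m h x) = g n x := by
    intro n m h x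
    refine (congrArg ((c.ι.app (Opposite.op (Opposite.op m))).hom) (key n m h x)).trans ?_
    exact congrArg (fun f => f.hom ((cmpL b i M n).symm x)) (c.w (homOfLE h).op.op)
  let G := Module.DirectLimit.lift R ℕ (EE b i M) (tr b i M) g hg
  refine ⟨(LinearEquiv.ofBijective G ⟨?_, ?_⟩).symm⟩
  · rw [injective_iff_map_eq_zero]
    intro a ha
    obtain ⟨n, e, rfl⟩ := io_surj a
    have h1 : g n e = 0 := by rw [← ha]; exact (Module.DirectLimit.lift_of _ _ _).symm
    have h2 : (c.ι.app (Opposite.op (Opposite.op n))) ((cmpL b i M n).symm e) =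
      (c.ι.app (Opposite.op (Opposite.op n))) 0 := by
      rw [map_zero]
      exact h1
    obtain ⟨k, f, g', hfg⟩ := (Concrete.isColimit_rep_eq_iff_exists _ hc _ _).1 h2
    rw [map_zero] at hfg
    have hk : n ≤ k.unop.unop := f.unop.unop.le
    have : tr b i M n k.unop.unop hk e = 0 := by
      rw [← (cmpL b i M n).apply_symm_apply e, ← cmpL_nat b i M n _ hk f]
      exact (congrArg _ hfg).trans (map_zero _)
    rw [← io_tr hk, this, map_zero]
  · intro y
    obtain ⟨j, y, rfl⟩ := Concrete.isColimit_exists_rep _ hc y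
    refine ⟨io b i M j.unop.unop (cmpL b i M j.unop.unop y), ?_⟩
    refine (Module.DirectLimit.lift_of _ _ _).trans ?_
    exact congrArg (c.ι.app j).hom ((cmpL b i M j.unop.unop).symm_apply_apply y)

end T1
end S19

namespace S19
open CategoryTheory.Limits

section T2
variable {R : Type} [CommRing R]

noncomputable def Dpost (b : Ideal R) {M N : ModuleCat.{0} R} {k : ℕ} (β : Abelian.Ext M N k)
    (i j : ℕ) (h : i + k = j) : DD b i M →ₗ[R] DD b j N :=
  Module.DirectLimit.map (fun n => β.postcompOfLinear R (Qm b n) h) (by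
    intro n m hnm
    ext e
    change ((Abelian.Ext.mk₀ (Qpr b hnm)).comp e (zero_add i)).comp β h =
      (Abelian.Ext.mk₀ (Qpr b hnm)).comp (e.comp β h) (zero_add j)
    rw [Abelian.Ext.comp_assoc]
    lia)

lemma Dpost_io (b : Ideal R) {M N : ModuleCat.{0} R} {k : ℕ} (β : Abelian.Ext M N k)
    (i j : ℕ) (h : i + k = j) (n : ℕ) (e : EE b i M n) :
    Dpost b β i j h (io b i M n e) = io b j N n (e.comp β h) :=
  Module.DirectLimit.map_apply_of _ _ _

lemma tr_comp (b : Ideal R) {M N : ModuleCat.{0} R} {k : ℕ} (β : Abelian.Ext M N k)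
    (i j : ℕ) (h : i + k = j) (n m : ℕ) (hnm : n ≤ m) (e : EE b i M n) :
    (tr b i M n m hnm e).comp β h = tr b j N n m hnm (e.comp β h) := by
  rw [tr_apply, tr_apply, Abelian.Ext.comp_assoc]
  lia

lemma Dpost_exact (b : Ideal R) {M N P : ModuleCat.{0} R} {k l : ℕ} (β : Abelian.Ext M N k)
    (γ : Abelian.Ext N P l)
    (i j j' : ℕ) (h : i + k = j) (h' : j + l = j')
    (H0 : β.comp γ rfl = 0)
    (H : ∀ (X : ModuleCat.{0} R) (e : Abelian.Ext X N j), e.comp γ h' = 0 →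
      ∃ e' : Abelian.Ext X M i, e'.comp β h = e) :
    Function.Exact (Dpost b β i j h) (Dpost b γ j j' h') := by
  intro z
  constructor
  · intro hz
    obtain ⟨n, e, rfl⟩ := io_surj z
    rw [Dpost_io] at hz
    obtain ⟨m, hm, hz⟩ := io_zero hz
    rw [← tr_comp] at hz
    obtain ⟨e', he'⟩ := H _ _ hz
    refine ⟨io b i M m e', ?_⟩
    rw [Dpost_io, he', io_tr]
  · rintro ⟨y, rfl⟩
    obtain ⟨n, e, rfl⟩ := io_surj y
    rw [Dpost_io, Dpost_io, Abelian.Ext.comp_assoc (a₂₃ := k + l) _ _ _ _ rfl (by lia), H0,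
      Abelian.Ext.comp_zero, map_zero]

/-- local cohomology of an unbundled module -/
abbrev D (b : Ideal R) (i : ℕ) (A : Type) [AddCommGroup A] [Module R A] : Type :=
  DD b i (ModuleCat.of R A)

variable {A B C : Type} [AddCommGroup A] [Module R A] [AddCommGroup B] [Module R B]
  [AddCommGroup C] [Module R C]

noncomputable def Dm (b : Ideal R) (i : ℕ) (f : A →ₗ[R] B) : D b i A →ₗ[R] D b i B :=
  Dpost b (Abelian.Ext.mk₀ (ModuleCat.ofHom f)) i i (add_zero i)

lemma Dm_comp (b : Ideal R) (i : ℕ) (f : A →ₗ[R] B) (g : B →ₗ[R] C) (z : D b i A) :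
    Dm b i g (Dm b i f z) = Dm b i (g ∘ₗ f) z := by
  obtain ⟨n, e, rfl⟩ := io_surj z
  simp only [Dm, Dpost_io, Abelian.Ext.comp_assoc_of_second_deg_zero, Abelian.Ext.mk₀_comp_mk₀,
    ModuleCat.ofHom_comp]

lemma Dm_smul_id (b : Ideal R) (i : ℕ) (x : R) (z : D b i A) :
    Dm b i (x • (LinearMap.id : A →ₗ[R] A)) z = x • z := by
  obtain ⟨n, e, rfl⟩ := io_surj z
  simp only [Dm, Dpost_io]
  rw [← map_smul, Abelian.Ext.smul_eq_comp_mk₀]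
  rfl

lemma Dm_zero (b : Ideal R) (i : ℕ) (z : D b i A) :
    Dm b i (0 : A →ₗ[R] B) z = 0 := by
  obtain ⟨n, e, rfl⟩ := io_surj z
  simp only [Dm, Dpost_io]
  have : (ModuleCat.ofHom (0 : A →ₗ[R] B)) = 0 := rfl
  rw [this, Abelian.Ext.mk₀_zero, Abelian.Ext.comp_zero, map_zero]

lemma Dm_id (b : Ideal R) (i : ℕ) (z : D b i A) :
    Dm b i (LinearMap.id : A →ₗ[R] A) z = z := by
  have := Dm_smul_id b i 1 z
  rwa [one_smul, one_smul] at this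

noncomputable def Dcongr (b : Ideal R) (i : ℕ) (e : A ≃ₗ[R] B) : D b i A ≃ₗ[R] D b i B :=
  LinearEquiv.ofLinearMap (Dm b i e.toLinearMap) (Dm b i e.symm.toLinearMap)
    (by refine LinearMap.ext fun z => ?_
        simp [Dm_comp, Dm_id, -Module.DirectLimit.map_apply_of])
    (by refine LinearMap.ext fun z => ?_
        simp [Dm_comp, Dm_id])

theorem les (b : Ideal R) (i : ℕ) (f : A →ₗ[R] B) (g : B →ₗ[R] C) (hf : Function.Injective f)
    (hfg : Function.Exact f g) (hg : Function.Surjective g) :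
    ∃ δ : D b i C →ₗ[R] D b (i+1) A, Function.Exact (Dm b i f) (Dm b i g) ∧
      Function.Exact (Dm b i g) δ ∧ Function.Exact δ (Dm b (i+1) f) := by
  let S : ShortComplex (ModuleCat.{0} R) := ShortComplex.mk (ModuleCat.ofHom f) (ModuleCat.ofHom g)
    (by ext x; exact hfg.apply_apply_eq_zero x)
  have hS : S.ShortExact := ModuleCat.shortComplex_shortExact S hfg hf hg
  refine ⟨Dpost b hS.extClass i (i+1) rfl, ?_, ?_, ?_⟩
  · refine Dpost_exact b _ _ _ _ _ _ _ ?_ ?_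
    · have h := S.zero
      change (Abelian.Ext.mk₀ S.f).comp (Abelian.Ext.mk₀ S.g) _ = 0
      rw [Abelian.Ext.mk₀_comp_mk₀, h, Abelian.Ext.mk₀_zero]
    · intro X e he
      exact Abelian.Ext.covariant_sequence_exact₂ X hS e he
  · refine Dpost_exact b _ _ _ _ _ _ _ ?_ ?_
    · exact hS.comp_extClass
    · intro X e he
      exact Abelian.Ext.covariant_sequence_exact₃ X hS e rfl he
  · refine Dpost_exact b _ _ _ _ _ _ _ ?_ ?_
    · exact hS.extClass_comp
    · intro X e he
      exact Abelian.Ext.covariant_sequence_exact₁ X hS e he rfl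

theorem Dm0_inj (b : Ideal R) (f : A →ₗ[R] B) (hf : Function.Injective f) :
    Function.Injective (Dm b 0 f) := by
  rw [injective_iff_map_eq_zero]
  intro z hz
  obtain ⟨n, e, rfl⟩ := io_surj z
  rw [Dm, Dpost_io] at hz
  obtain ⟨m, hm, hz⟩ := io_zero hz
  rw [← tr_comp] at hz
  have : Mono (ModuleCat.ofHom f) := (ModuleCat.mono_iff_injective _).2 hf
  have h2 := Abelian.Ext.postcomp_mk₀_injective_of_mono (Qm b m) (ModuleCat.ofHom f)
  have h3 := (injective_iff_map_eq_zero _).1 h2 _ hz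
  rw [← io_tr hm, h3, map_zero]

end T2
end S19

namespace S19
open CategoryTheory.Limits

section T1b
variable {R : Type} [CommRing R]

/-- power torsion -/
def Gam (b : Ideal R) (N : Type) [AddCommGroup N] [Module R N] : Submodule R N where
  carrier := {x | ∃ n : ℕ, ∀ a ∈ b ^ n, a • x = 0}
  zero_mem' := ⟨0, by simp⟩
  add_mem' := by
    rintro x y ⟨n, hn⟩ ⟨m, hm⟩
    refine ⟨n + m, fun a ha => ?_⟩
    rw [smul_add, hn a (Ideal.pow_le_pow_right (by lia) ha),
      hm a (Ideal.pow_le_pow_right (by lia) ha), add_zero]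
  smul_mem' := by
    rintro c x ⟨n, hn⟩
    refine ⟨n, fun a ha => ?_⟩
    rw [smul_comm, hn a ha, smul_zero]

lemma mem_Gam {b : Ideal R} {N : Type} [AddCommGroup N] [Module R N] {x : N} :
    x ∈ Gam b N ↔ ∃ n : ℕ, ∀ a ∈ b ^ n, a • x = 0 := Iff.rfl

variable {M : ModuleCat.{0} R} (I : InjectiveResolution M)

abbrev Jm (i : ℕ) : Type := I.cocomplex.X i

noncomputable def dm (i : ℕ) : Jm I i →ₗ[R] Jm I (i+1) := (I.cocomplex.d i (i+1)).hom

lemma dm_dm (i : ℕ) (z : Jm I i) : dm I (i+1) (dm I i z) = 0 :=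
  congrArg (fun f => f.hom z) (I.cocomplex.d_comp_d i (i+1) (i+1+1))

lemma Gam_map {b : Ideal R} {N N' : Type} [AddCommGroup N] [Module R N] [AddCommGroup N']
    [Module R N'] (f : N →ₗ[R] N') {x : N} (hx : x ∈ Gam b N) : f x ∈ Gam b N' := by
  obtain ⟨n, hn⟩ := hx
  exact ⟨n, fun a ha => by rw [← map_smul, hn a ha, map_zero]⟩

noncomputable def Zb (b : Ideal R) (i : ℕ) : Submodule R (Jm I i) :=
  LinearMap.ker (dm I i) ⊓ Gam b (Jm I i)

noncomputable def Bd (b : Ideal R) : ∀ i, Submodule R (Jm I i)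
  | 0 => ⊥
  | (i+1) => (Gam b (Jm I i)).map (dm I i)

lemma Bd_le_Zb (b : Ideal R) (i : ℕ) : Bd I b i ≤ Zb I b i := by
  cases i with
  | zero => exact bot_le
  | succ i =>
    rintro _ ⟨w, hw, rfl⟩
    exact ⟨dm_dm I i w, Gam_map _ hw⟩

noncomputable def hm (b : Ideal R) (i n : ℕ) (z : Jm I i) (hz : ∀ a ∈ b ^ n, a • z = 0) :
    Qm b n ⟶ I.cocomplex.X i :=
  ModuleCat.ofHom (Submodule.liftQ (b ^ n) (LinearMap.toSpanSingleton R (Jm I i) z) (fun a ha => hz a ha))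

lemma hm_mk (b : Ideal R) (i n : ℕ) (z : Jm I i) (hz : ∀ a ∈ b ^ n, a • z = 0) (r : R) :
    (hm I b i n z hz).hom (Submodule.Quotient.mk r) = r • z := rfl

lemma Qm_hom_ext (b : Ideal R) (n : ℕ) {N : ModuleCat.{0} R} {f g : Qm b n ⟶ N}
    (h : f.hom (Submodule.Quotient.mk 1) = g.hom (Submodule.Quotient.mk 1)) : f = g := by
  apply ModuleCat.hom_ext
  refine LinearMap.ext fun x => ?_
  obtain ⟨r, rfl⟩ := Submodule.Quotient.mk_surjective _ x
  have : (Submodule.Quotient.mk r : R ⧸ b ^ n) = r • Submodule.Quotient.mk 1 := by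
    rw [← Submodule.Quotient.mk_smul, smul_eq_mul, mul_one]
  rw [this]
  exact ((f.hom.map_smul r _).trans (congrArg (r • ·) h)).trans (g.hom.map_smul r _).symm

lemma hm_d (b : Ideal R) (i n : ℕ) (z : Jm I i) (hz : ∀ a ∈ b ^ n, a • z = 0)
    (hd : dm I i z = 0) : hm I b i n z hz ≫ I.cocomplex.d i (i+1) = 0 := by
  apply Qm_hom_ext
  change dm I i ((1:R) • z) = 0
  rw [one_smul, hd]

noncomputable def cln (b : Ideal R) (i n : ℕ) (z : Jm I i) (hz : ∀ a ∈ b ^ n, a • z = 0)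
    (hd : dm I i z = 0) : D b i M :=
  io b i M n (I.extMk (hm I b i n z hz) (i+1) rfl (hm_d I b i n z hz hd))

lemma cln_le (b : Ideal R) (i n m : ℕ) (h : n ≤ m) (z : Jm I i) (hz : ∀ a ∈ b ^ n, a • z = 0)
    (hz' : ∀ a ∈ b ^ m, a • z = 0) (hd : dm I i z = 0) :
    cln I b i m z hz' hd = cln I b i n z hz hd := by
  unfold cln
  rw [← io_tr h, tr_apply, I.mk₀_comp_extMk]
  have : Qpr b h ≫ hm I b i n z hz = hm I b i m z hz' := by
    apply Qm_hom_ext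
    rfl
  simp only [this]

noncomputable def clF (b : Ideal R) (i : ℕ) (z : Zb I b i) : D b i M :=
  cln I b i z.2.2.choose z.1 z.2.2.choose_spec z.2.1

lemma clF_eq (b : Ideal R) (i n : ℕ) (z : Zb I b i) (hz : ∀ a ∈ b ^ n, a • z.1 = 0) :
    clF I b i z = cln I b i n z.1 hz z.2.1 := by
  unfold clF
  have h := z.2.2.choose_spec
  have h3 : ∀ a ∈ b ^ (max n z.2.2.choose), a • z.1 = 0 := fun a ha =>
    hz a (Ideal.pow_le_pow_right (le_max_left _ _) ha)
  rw [← cln_le I b i n _ (le_max_left _ _) z.1 hz h3 z.2.1,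
    ← cln_le I b i _ _ (le_max_right _ _) z.1 h h3 z.2.1]

noncomputable def cl (b : Ideal R) (i : ℕ) : Zb I b i →ₗ[R] D b i M where
  toFun := clF I b i
  map_add' x y := by
    obtain ⟨n, hn⟩ := x.2.2
    obtain ⟨m, hm'⟩ := y.2.2
    have h1 : ∀ a ∈ b ^ (n + m), a • x.1 = 0 := fun a ha =>
      hn a (Ideal.pow_le_pow_right (by lia) ha)
    have h2 : ∀ a ∈ b ^ (n + m), a • y.1 = 0 := fun a ha =>
      hm' a (Ideal.pow_le_pow_right (by lia) ha)
    have h3 : ∀ a ∈ b ^ (n + m), a • (x + y).1 = 0 := fun a ha => by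
      change a • (x.1 + y.1) = 0
      rw [smul_add, h1 a ha, h2 a ha, add_zero]
    rw [clF_eq I b i _ x h1, clF_eq I b i _ y h2, clF_eq I b i _ (x+y) h3]
    unfold cln
    rw [← map_add, I.add_extMk]
    have : hm I b i _ (x+y).1 h3 = hm I b i _ x.1 h1 + hm I b i _ y.1 h2 := by
      apply Qm_hom_ext
      change (1:R) • (x.1 + y.1) = (1:R) • x.1 + (1:R) • y.1
      rw [smul_add]
    simp only [this]
  map_smul' r x := by
    obtain ⟨n, h1⟩ := x.2.2
    have h3 : ∀ a ∈ b ^ n, a • (r • x).1 = 0 := fun a ha => by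
      change a • r • x.1 = 0
      rw [smul_comm, h1 a ha, smul_zero]
    rw [clF_eq I b i _ x h1, clF_eq I b i _ (r • x) h3]
    unfold cln
    rw [RingHom.id_apply, ← map_smul]
    congr 1
    have e1 : hm I b i _ (r • x).1 h3 =
        ModuleCat.ofHom (r • (LinearMap.id : (R ⧸ b ^ n) →ₗ[R] _)) ≫ hm I b i _ x.1 h1 := by
      apply Qm_hom_ext
      change (1:R) • r • x.1 = (hm I b i _ x.1 h1).hom (r • Submodule.Quotient.mk 1)
      rw [one_smul]
      refine Eq.trans ?_ ((hm I b i _ x.1 h1).hom.map_smul r _).symm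
      rw [hm_mk, one_smul]
    simp only [e1]
    rw [← I.mk₀_comp_extMk _ _ _ (hm_d I b i n x.1 h1 x.2.1)]
    have e2 : Abelian.Ext.mk₀ (ModuleCat.ofHom (r • (LinearMap.id : (R ⧸ b ^ n) →ₗ[R] _))) =
       r • Abelian.Ext.mk₀ (𝟙 (Qm b n)) := by
      rw [← Abelian.Ext.mk₀_smul]
      rfl
    rw [e2, Abelian.Ext.smul_comp, Abelian.Ext.mk₀_id_comp]

lemma cl_surj (b : Ideal R) (i : ℕ) : Function.Surjective (cl I b i) := by
  intro y
  obtain ⟨n, e, rfl⟩ := io_surj y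
  obtain ⟨f, hf, rfl⟩ := I.extMk_surjective e (i+1) rfl
  let z : Jm I i := f.hom (Submodule.Quotient.mk 1)
  have hz : ∀ a ∈ b ^ n, a • z = 0 := by
    intro a ha
    refine (f.hom.map_smul a (Submodule.Quotient.mk 1)).symm.trans ?_
    have : a • (Submodule.Quotient.mk 1 : R ⧸ b ^ n) = 0 := by
      rw [← Submodule.Quotient.mk_smul, smul_eq_mul, mul_one, Submodule.Quotient.mk_eq_zero]
      exact ha
    rw [this]
    exact map_zero _
  have hd : dm I i z = 0 := congrArg (fun g => g.hom (Submodule.Quotient.mk 1)) hf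
  refine ⟨⟨z, hd, n, hz⟩, ?_⟩
  refine (clF_eq I b i n _ hz).trans ?_
  unfold cln
  have : hm I b i n z hz = f := by
    apply Qm_hom_ext
    rw [hm_mk, one_smul]
  simp only [this]

open CochainComplex.HomComplex in
lemma extMk_eq_zero_zero' {C : Type*} [Category C] [Abelian C] [HasExt C] {X Y : C}
    (P : InjectiveResolution Y) (f : X ⟶ P.cocomplex.X 0) (m : ℕ) (hm : 0 + 1 = m)
    (hf : f ≫ P.cocomplex.d 0 m = 0) : P.extMk f m hm hf = 0 ↔ f = 0 := by
  constructor
  · intro h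
    have h2 := h
    simp only [← P.extEquivCohomologyClass.apply_eq_iff_eq,
      InjectiveResolution.extEquivCohomologyClass_extMk, InjectiveResolution.extEquivCohomologyClass_zero,
      CohomologyClass.mk_eq_zero_iff] at h2
    rw [Cocycle.fromSingleMk_mem_coboundaries_iff _ _ _ _ _ (-1) (by lia)] at h2
    obtain ⟨g, hg⟩ := h2
    have hz : IsZero (P.cochainComplex.X (-1)) := P.cochainComplex.isZero_of_isStrictlyGE 0 (-1) (by lia)
    rw [hz.eq_of_tgt g 0, zero_comp] at hg
    rw [← cancel_mono (P.cochainComplexXIso 0 0 rfl).inv, zero_comp]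
    exact hg.symm
  · rintro rfl
    simp

lemma cl_zero (b : Ideal R) (i : ℕ) (z : Zb I b i) : cl I b i z = 0 ↔ z.1 ∈ Bd I b i := by
  constructor
  · intro h
    obtain ⟨n, hn⟩ := z.2.2
    have h1 : cln I b i n z.1 hn z.2.1 = 0 := (clF_eq I b i n z hn).symm.trans h
    obtain ⟨m, hnm, h2⟩ := io_zero h1
    have hm' : ∀ a ∈ b ^ m, a • z.1 = 0 := fun a ha => hn a (Ideal.pow_le_pow_right hnm ha)
    rw [tr_apply, I.mk₀_comp_extMk] at h2
    have e : Qpr b hnm ≫ hm I b i n z.1 hn = hm I b i m z.1 hm' := by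
      apply Qm_hom_ext
      rfl
    simp only [e] at h2
    cases i with
    | zero =>
      rw [extMk_eq_zero_zero'] at h2
      have := congrArg (fun f => f.hom (Submodule.Quotient.mk 1)) h2
      change (1:R) • z.1 = 0 at this
      rw [one_smul] at this
      rw [this]
      exact zero_mem _
    | succ i =>
      rw [I.extMk_eq_zero_iff _ _ _ _ i rfl] at h2
      obtain ⟨g, hg⟩ := h2
      refine ⟨g.hom (Submodule.Quotient.mk 1), ⟨m, fun a ha => ?_⟩, ?_⟩
      · refine (g.hom.map_smul a (Submodule.Quotient.mk 1)).symm.trans ?_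
        have : a • (Submodule.Quotient.mk 1 : R ⧸ b ^ m) = 0 := by
          rw [← Submodule.Quotient.mk_smul, smul_eq_mul, mul_one, Submodule.Quotient.mk_eq_zero]
          exact ha
        rw [this]
        exact map_zero _
      · have := congrArg (fun f => f.hom (Submodule.Quotient.mk 1)) hg
        refine Eq.trans this ?_
        rw [hm_mk, one_smul]
  · intro h
    cases i with
    | zero =>
      have : z = 0 := Subtype.ext h
      rw [this, map_zero]
    | succ i =>
      obtain ⟨w, ⟨n, hn⟩, hw⟩ := h
      have hn' : ∀ a ∈ b ^ n, a • z.1 = 0 := fun a ha => by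
        rw [← hw, ← map_smul, hn a ha, map_zero]
      refine (clF_eq I b (i+1) n z hn').trans ?_
      unfold cln
      have : I.extMk (hm I b (i+1) n z.1 hn') (i+1+1) rfl (hm_d I b (i+1) n z.1 hn' z.2.1) = 0 := by
        rw [I.extMk_eq_zero_iff _ _ _ _ i rfl]
        refine ⟨hm I b i n w hn, ?_⟩
        apply Qm_hom_ext
        change dm I i ((1:R) • w) = (1:R) • z.1
        rw [one_smul, one_smul, hw]
      rw [this, map_zero]

lemma Jm_exact (i : ℕ) (z : Jm I (i+1)) (hz : dm I (i+1) z = 0) : ∃ w, dm I i w = z :=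
  (ShortComplex.moduleCat_exact_iff _).1 (I.exact_succ i) z hz

lemma Jm_inj (i : ℕ) : Module.Injective R (Jm I i) :=
  Module.injective_module_of_injective_object (inj := I.injective i) R (I.cocomplex.X i)

lemma Jm_zero : ∃ ε : M →ₗ[R] Jm I 0, Function.Injective ε ∧ (∀ x, dm I 0 (ε x) = 0) ∧
    ∀ z, dm I 0 z = 0 → ∃ x, ε x = z := by
  refine ⟨(I.ι.f 0).hom, (ModuleCat.mono_iff_injective _).1 inferInstance, ?_, ?_⟩
  · intro x
    have := I.ι_f_zero_comp_complex_d
    exact congrArg (fun f => f.hom x) this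
  · intro z hz
    exact (ShortComplex.moduleCat_exact_iff _).1 I.exact₀ z hz

end T1b
end S19

namespace S19
open CategoryTheory.Limits

section T3
set_option linter.unusedSectionVars false
variable {R : Type} [CommRing R]

lemma divis [IsNoetherianRing R] {N : Type} [AddCommGroup N] [Module R N] (hN : Module.Injective R N)
    (b : Ideal R) (x : R) {w : N} (hw : w ∈ Gam b N) :
    ∃ u ∈ Gam b N, ∃ k : ℕ, x ^ k • (w - x • u) = 0 := by
  obtain ⟨n, hn⟩ := hw
  let f : (R ⧸ b ^ n) →ₗ[R] (R ⧸ b ^ n) := x • LinearMap.id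
  obtain ⟨k, hk⟩ := monotone_stabilizes_iff_noetherian.2 (inferInstance : IsNoetherian R (R ⧸ b ^ n))
    (LinearMap.iterateKer f)
  let g0 : (R ⧸ b ^ n) →ₗ[R] N := Submodule.liftQ (b ^ n) (LinearMap.toSpanSingleton R N w)
    (fun a ha => hn a ha)
  let h : (R ⧸ b ^ n) →ₗ[R] (R ⧸ b ^ n) := f ^ (k+1)
  let g : (R ⧸ b ^ n) →ₗ[R] N := g0 ∘ₗ (f ^ k)
  have hle : LinearMap.ker h ≤ LinearMap.ker g := by
    intro s hs
    have h1 : LinearMap.ker (f ^ k) = LinearMap.ker (f ^ (k+1)) := hk (k+1) (by lia)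
    have : s ∈ LinearMap.ker (f ^ k) := h1 ▸ hs
    change g0 ((f ^ k) s) = 0
    rw [LinearMap.mem_ker.1 this, map_zero]
  have hinj : Function.Injective ((LinearMap.ker h).liftQ h le_rfl) := by
    rw [← LinearMap.ker_eq_bot]
    exact Submodule.ker_liftQ_eq_bot _ _ _ le_rfl
  obtain ⟨φ, hφ⟩ := hN.out _ hinj ((LinearMap.ker h).liftQ g hle)
  have hfp : ∀ j s, (f ^ j) s = x ^ j • s := by
    intro j s
    have : f ^ j = x ^ j • LinearMap.id := by
      simp only [f]
      rw [smul_pow, ← Module.End.one_eq_id, one_pow]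
    rw [this]; rfl
  let o : R ⧸ b ^ n := Submodule.Quotient.mk 1
  have key : φ (h o) = g o := hφ (Submodule.Quotient.mk o)
  have hg0 : g0 o = w := by
    change (1:R) • w = w
    rw [one_smul]
  refine ⟨φ o, ⟨n, fun a ha => ?_⟩, k, ?_⟩
  · rw [← map_smul]
    have : a • o = 0 := by
      simp only [o]
      rw [← Submodule.Quotient.mk_smul, smul_eq_mul, mul_one, Submodule.Quotient.mk_eq_zero]
      exact ha
    rw [this, map_zero]
  · have k2 : x ^ (k+1) • φ o = x ^ k • w := by
      rw [← map_smul, ← hfp]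
      refine key.trans ?_
      change g0 ((f ^ k) o) = _
      rw [hfp, map_smul, hg0]
    rw [smul_sub, smul_smul, ← pow_succ, k2, sub_self]

lemma Gam_mono {b c : Ideal R} (h : b ≤ c) (N : Type) [AddCommGroup N] [Module R N] :
    Gam c N ≤ Gam b N := by
  rintro w ⟨n, hn⟩
  exact ⟨n, fun a ha => hn a (Ideal.pow_right_mono h n ha)⟩

lemma Gam_pow {b : Ideal R} {x : R} (hx : x ∈ b) {N : Type} [AddCommGroup N] [Module R N] {w : N}
    (hw : w ∈ Gam b N) : ∃ k : ℕ, x ^ k • w = 0 := by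
  obtain ⟨n, hn⟩ := hw
  exact ⟨n, hn _ (Ideal.pow_mem_pow hx n)⟩

/-- add one generator -/
abbrev adj (b : Ideal R) (x : R) : Ideal R := b ⊔ Ideal.span {x}

lemma Gam_adj {b : Ideal R} {x : R} {N : Type} [AddCommGroup N] [Module R N] {w : N}
    (hw : w ∈ Gam b N) {k : ℕ} (hk : x ^ k • w = 0) : w ∈ Gam (adj b x) N := by
  obtain ⟨n, hn⟩ := hw
  refine ⟨n + k, fun a ha => ?_⟩
  have := Ideal.sup_pow_add_le_pow_sup_pow ha
  obtain ⟨p, hp, q, hq, rfl⟩ := Submodule.mem_sup.1 this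
  rw [Ideal.span_singleton_pow, Ideal.mem_span_singleton'] at hq
  obtain ⟨c, rfl⟩ := hq
  rw [add_smul, hn p hp, mul_smul, hk, smul_zero, add_zero]

lemma Gam_span {x : R} {N : Type} [AddCommGroup N] [Module R N] {w : N} :
    w ∈ Gam (Ideal.span {x}) N ↔ ∃ k : ℕ, x ^ k • w = 0 := by
  constructor
  · exact Gam_pow (Ideal.mem_span_singleton_self x)
  · rintro ⟨k, hk⟩
    refine ⟨k, fun a ha => ?_⟩
    rw [Ideal.span_singleton_pow, Ideal.mem_span_singleton'] at ha
    obtain ⟨c, rfl⟩ := ha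
    rw [mul_smul, hk, smul_zero]

variable [IsNoetherianRing R] {M : ModuleCat.{0} R} (I : InjectiveResolution M)

lemma core (b : Ideal R) (x : R) (i : ℕ) (w : Jm I i) (hw : w ∈ Gam b (Jm I i)) (K : ℕ)
    (h : x ^ K • w ∈ Bd I b i) : ∃ e ∈ Bd I b i, w - e ∈ Gam (adj b x) (Jm I i) := by
  cases i with
  | zero =>
    refine ⟨0, zero_mem _, ?_⟩
    rw [sub_zero]
    exact Gam_adj hw (k := K) h
  | succ i =>
    obtain ⟨t, ht, hte⟩ := h
    obtain ⟨u, hu, l, hl⟩ := divis (Jm_inj I i) b (x ^ K) ht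
    refine ⟨dm I i u, ⟨u, hu, rfl⟩, ?_⟩
    refine Gam_adj (Submodule.sub_mem _ hw (Gam_map _ hu)) (k := K * l + K) ?_
    rw [pow_add, mul_smul, smul_sub, ← hte, ← map_smul, ← map_sub, pow_mul, ← map_smul, hl, map_zero]

lemma Zb_mono {b c : Ideal R} (h : b ≤ c) (i : ℕ) : Zb I c i ≤ Zb I b i :=
  inf_le_inf le_rfl (Gam_mono h _)

/-- artinian transfer along a correspondence -/
lemma artin_of {P X Y : Type} [AddCommGroup P] [Module R P] [AddCommGroup X] [Module R X]
    [AddCommGroup Y] [Module R Y] (p : P →ₗ[R] X) (s : P →ₗ[R] Y) (h : LinearMap.ker p ≤ LinearMap.ker s)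
    (hX : IsArtinian R X) : IsArtinian R (LinearMap.range s) := by
  have e := p.quotKerEquivRange
  have h1 : IsArtinian R (P ⧸ LinearMap.ker p) := isArtinian_of_linearEquiv e.symm
  refine isArtinian_of_surjective (P ⧸ LinearMap.ker p) ((LinearMap.ker p).liftQ s.rangeRestrict ?_) ?_
  · rwa [LinearMap.ker_rangeRestrict]
  · intro y
    obtain ⟨z, hz⟩ := s.surjective_rangeRestrict y
    exact ⟨Submodule.Quotient.mk z, hz⟩

theorem alpha' (I : InjectiveResolution M) (b : Ideal R) (x : R) (i : ℕ) (h : IsArtinian R (D (adj b x) i M)) :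
    IsArtinian R (Gam (Ideal.span {x}) (D b i M)) := by
  let s : Zb I (adj b x) i →ₗ[R] D b i M :=
    cl I b i ∘ₗ Submodule.inclusion (Zb_mono I (le_sup_left : b ≤ adj b x) i)
  have h1 : IsArtinian R (LinearMap.range s) := by
    refine artin_of (cl I (adj b x) i) s ?_ h
    intro z hz
    have hz2 := (cl_zero I (adj b x) i z).1 hz
    refine (cl_zero I b i _).2 ?_
    cases i with
    | zero => exact hz2
    | succ i => exact Submodule.map_mono (Gam_mono le_sup_left _) hz2
  refine isArtinian_of_le (s := Gam (Ideal.span {x}) (D b i M)) (t := LinearMap.range s) ?_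
  intro y hy
  obtain ⟨k, hk⟩ := Gam_span.1 hy
  obtain ⟨z, rfl⟩ := cl_surj I b i y
  rw [← map_smul, cl_zero] at hk
  obtain ⟨e, he, he2⟩ := core I b x i z.1 z.2.2 k hk
  refine ⟨⟨z.1 - e, Submodule.sub_mem _ z.2.1 (Bd_le_Zb I b i he).1, he2⟩, ?_⟩
  have : (Submodule.inclusion (Zb_mono I (le_sup_left : b ≤ adj b x) i))
    ⟨z.1 - e, Submodule.sub_mem _ z.2.1 (Bd_le_Zb I b i he).1, he2⟩ = z - ⟨e, Bd_le_Zb I b i he⟩ := rfl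
  change cl I b i _ = _
  rw [this, map_sub, (cl_zero I b i ⟨e, _⟩).2 he, sub_zero]

theorem gamma' (I : InjectiveResolution M) (b : Ideal R) (x : R) (i : ℕ) (h : ∀ y : D b i M, ∃ k : ℕ, x ^ k • y = 0)
    (h0 : Subsingleton (D b (i+1) M)) : Subsingleton (D (adj b x) (i+1) M) := by
  refine subsingleton_of_forall_eq 0 fun y => ?_
  obtain ⟨z, rfl⟩ := cl_surj I (adj b x) (i+1) y
  rw [cl_zero]
  have h2 : cl I b (i+1) ⟨z.1, Zb_mono I le_sup_left _ z.2⟩ = 0 := Subsingleton.elim _ _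
  rw [cl_zero] at h2
  obtain ⟨w, hw, hwz⟩ := h2
  obtain ⟨k, hk⟩ := Gam_pow (x := x) (Ideal.mem_sup_right (Ideal.mem_span_singleton_self x)) z.2.2
  have hc : x ^ k • w ∈ Zb I b i := by
    refine ⟨?_, Submodule.smul_mem _ _ hw⟩
    change dm I i _ = 0
    rw [map_smul, hwz]; exact hk
  obtain ⟨l, hl⟩ := h (cl I b i ⟨_, hc⟩)
  rw [← map_smul, cl_zero] at hl
  obtain ⟨e, he, he2⟩ := core I b x i w hw (l + k) (by rw [pow_add, mul_smul]; exact hl)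
  refine ⟨w - e, he2, ?_⟩
  rw [map_sub, hwz]
  have : dm I i e = 0 := (Bd_le_Zb I b i he).1
  rw [this, sub_zero]

lemma bot' (I : InjectiveResolution M) (i : ℕ) : Subsingleton (D (⊥ : Ideal R) (i+1) M) := by
  refine subsingleton_of_forall_eq 0 fun y => ?_
  obtain ⟨z, rfl⟩ := cl_surj I ⊥ (i+1) y
  rw [cl_zero]
  obtain ⟨w, hw⟩ := Jm_exact I i z.1 z.2.1
  refine ⟨w, ⟨1, fun a ha => ?_⟩, hw⟩
  rw [pow_one] at ha
  rw [(Submodule.mem_bot R).1 ha, zero_smul]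

lemma tors' (I : InjectiveResolution M) (b : Ideal R) (i : ℕ) (y : D b i M) : y ∈ Gam b (D b i M) := by
  obtain ⟨z, rfl⟩ := cl_surj I b i y
  apply Gam_map
  obtain ⟨n, hn⟩ := z.2.2
  exact ⟨n, fun a ha => Subtype.ext (hn a ha)⟩

noncomputable def Y1 (b : Ideal R) (x : R) (i : ℕ) : Submodule R (Jm I i × Jm I i) :=
  (Gam b (Jm I i)).prod (Gam (adj b x) (Jm I i)) ⊓
    LinearMap.ker (dm I i ∘ₗ (x • LinearMap.fst R _ _ + LinearMap.snd R _ _))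

theorem beta' (I : InjectiveResolution M) (b : Ideal R) (x : R) (i : ℕ) (h : IsArtinian R (D (adj b x) (i+1) M)) :
    IsArtinian R (D b i M ⧸ (Gam (Ideal.span {x}) (D b i M) ⊔
      LinearMap.range (x • (LinearMap.id : D b i M →ₗ[R] D b i M)))) := by
  have hbc : b ≤ adj b x := le_sup_left
  have hrel : ∀ y ∈ Y1 I b x i, x • dm I i y.1 = - dm I i y.2 := by
    intro y hy
    have : dm I i (x • y.1 + y.2) = 0 := hy.2
    rw [map_add, map_smul] at this
    exact eq_neg_of_add_eq_zero_left this
  let φ0 : Y1 I b x i →ₗ[R] Zb I (adj b x) (i+1) :=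
    LinearMap.codRestrict _ (dm I i ∘ₗ LinearMap.fst R _ _ ∘ₗ (Y1 I b x i).subtype) (by
      intro y
      refine ⟨dm_dm I i _, ?_⟩
      obtain ⟨k, hk⟩ := Gam_pow (x := x) (Ideal.mem_sup_right (Ideal.mem_span_singleton_self x)) y.2.1.2
      refine Gam_adj (Gam_map (dm I i) y.2.1.1) (k := k + 1) ?_
      change x ^ (k+1) • dm I i y.1.1 = 0
      rw [pow_succ, mul_smul, hrel y.1 y.2, smul_neg, ← map_smul, hk, map_zero, neg_zero])
  let ψ0 : Y1 I b x i →ₗ[R] Zb I b i :=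
    LinearMap.codRestrict _ ((x • LinearMap.fst R _ _ + LinearMap.snd R _ _) ∘ₗ (Y1 I b x i).subtype) (by
      intro y
      exact ⟨y.2.2, Submodule.add_mem _ (Submodule.smul_mem _ _ y.2.1.1) (Gam_mono hbc _ y.2.1.2)⟩)
  set W := Gam (Ideal.span {x}) (D b i M) ⊔
      LinearMap.range (x • (LinearMap.id : D b i M →ₗ[R] D b i M)) with hW
  let ψ := W.mkQ ∘ₗ cl I b i ∘ₗ ψ0
  have hker : LinearMap.ker (cl I (adj b x) (i+1) ∘ₗ φ0) ≤ LinearMap.ker ψ := by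
    intro y hy
    have hy' := (cl_zero I (adj b x) (i+1) (φ0 y)).1 hy
    obtain ⟨t, ht, hte⟩ := hy'
    have hte : dm I i t = dm I i y.1.1 := hte
    have hc1 : y.1.1 - t ∈ Zb I b i := by
      refine ⟨?_, Submodule.sub_mem _ y.2.1.1 (Gam_mono hbc _ ht)⟩
      change dm I i _ = 0
      rw [map_sub, hte, sub_self]
    have hc2 : x • t + y.1.2 ∈ Zb I b i := by
      refine ⟨?_, Submodule.add_mem _ (Submodule.smul_mem _ _ (Gam_mono hbc _ ht))
        (Gam_mono hbc _ y.2.1.2)⟩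
      change dm I i _ = 0
      rw [map_add, map_smul, hte, hrel y.1 y.2, neg_add_cancel]
    have hsum : ψ0 y = x • (⟨_, hc1⟩ : Zb I b i) + ⟨_, hc2⟩ := by
      apply Subtype.ext
      change x • y.1.1 + y.1.2 = x • (y.1.1 - t) + (x • t + y.1.2)
      rw [smul_sub]; abel
    change W.mkQ (cl I b i (ψ0 y)) = 0
    rw [← LinearMap.mem_ker, Submodule.ker_mkQ, hsum, map_add, map_smul]
    refine W.add_mem (Submodule.mem_sup_right ⟨cl I b i ⟨_, hc1⟩, rfl⟩) (Submodule.mem_sup_left ?_)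
    rw [Gam_span]
    obtain ⟨k, hk⟩ := Gam_pow (x := x) (Ideal.mem_sup_right (Ideal.mem_span_singleton_self x))
      (Submodule.add_mem _ (Submodule.smul_mem _ x ht) y.2.1.2)
    refine ⟨k, ?_⟩
    rw [← map_smul]
    have : x ^ k • (⟨_, hc2⟩ : Zb I b i) = 0 := Subtype.ext hk
    rw [this, map_zero]
  have hA := artin_of _ ψ hker h
  have hs : Function.Surjective ψ := by
    refine (Submodule.mkQ_surjective W).comp ((cl_surj I b i).comp ?_)
    intro z
    obtain ⟨u, hu, k, hk⟩ := divis (Jm_inj I i) b x z.2.2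
    have e : x • u + (z.1 - x • u) = z.1 := by abel
    refine ⟨⟨(u, z.1 - x • u), ⟨⟨hu, ?_⟩, ?_⟩⟩, ?_⟩
    · exact Gam_adj (Submodule.sub_mem _ z.2.2 (Submodule.smul_mem _ _ hu)) hk
    · change dm I i (x • u + (z.1 - x • u)) = 0
      rw [e]; exact z.2.1
    · exact Subtype.ext e
  rw [LinearMap.range_eq_top.2 hs] at hA
  exact isArtinian_of_linearEquiv (Submodule.topEquiv)

end T3

section T3b
set_option linter.unusedSectionVars false
variable {R : Type} [CommRing R] [IsNoetherianRing R] (A : Type) [AddCommGroup A] [Module R A]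

lemma exres : Nonempty (InjectiveResolution (ModuleCat.of R A)) := ⟨injectiveResolution _⟩

theorem alpha (b : Ideal R) (x : R) (i : ℕ) (h : IsArtinian R (D (adj b x) i A)) :
    IsArtinian R (Gam (Ideal.span {x}) (D b i A)) := alpha' (exres A).some b x i h

theorem beta (b : Ideal R) (x : R) (i : ℕ) (h : IsArtinian R (D (adj b x) (i+1) A)) :
    IsArtinian R (D b i A ⧸ (Gam (Ideal.span {x}) (D b i A) ⊔
      LinearMap.range (x • (LinearMap.id : D b i A →ₗ[R] D b i A)))) := beta' (exres A).some b x i h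

theorem Dtors (b : Ideal R) (i : ℕ) (y : D b i A) : y ∈ Gam b (D b i A) := tors' (exres A).some b i y

theorem lemV (i : ℕ) (m : Ideal R)
    (h : ∀ (b : Ideal R), ∀ x ∈ m, ∀ y : D b i A, ∃ k : ℕ, x ^ k • y = 0) :
    Subsingleton (D m (i+1) A) := by
  obtain ⟨s, rfl⟩ := IsNoetherian.noetherian m
  have key : ∀ t : Finset R, (t : Set R) ⊆ Ideal.span (s : Set R) →
      Subsingleton (D (Ideal.span (t : Set R)) (i+1) A) := by
    classical
    intro t
    induction t using Finset.induction_on with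
    | empty =>
      intro _
      have : Ideal.span ((∅ : Finset R) : Set R) = ⊥ := by simp
      rw [this]
      exact bot' (exres A).some i
    | insert x t _ ih =>
      intro ht
      have h1 := ih (fun y hy => ht (by simp [Finset.mem_coe.1 hy]))
      have e : Ideal.span ((insert x t : Finset R) : Set R) = adj (Ideal.span (t : Set R)) x := by
        rw [Finset.coe_insert, Ideal.span_insert, sup_comm]
      rw [e]
      exact gamma' (exres A).some _ x i (h _ x (ht (by simp))) h1
  exact key s Ideal.subset_span

theorem lemV_tors (i : ℕ) (m : Ideal R) (h : ∀ x ∈ m, ∃ k : ℕ, ∀ a : A, x ^ k • a = 0) :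
    Subsingleton (D m (i+1) A) := by
  refine lemV A i m fun b x hx y => ?_
  obtain ⟨k, hk⟩ := h x hx
  refine ⟨k, ?_⟩
  rw [← Dm_smul_id]
  have : x ^ k • (LinearMap.id : A →ₗ[R] A) = 0 := LinearMap.ext hk
  rw [this, Dm_zero]

theorem D0 (b : Ideal R) : Nonempty (D b 0 A ≃ₗ[R] Gam b A) := by
  let I := (exres (R := R) A).some
  obtain ⟨ε, h1, h2, h3⟩ := Jm_zero I
  have e1 : Zb I b 0 ≃ₗ[R] D b 0 A := LinearEquiv.ofBijective (cl I b 0) ⟨by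
    rw [injective_iff_map_eq_zero]
    intro z hz
    exact Subtype.ext ((cl_zero I b 0 z).1 hz), cl_surj I b 0⟩
  have hmem : ∀ a : Gam b A, ε a.1 ∈ Zb I b 0 := fun a => ⟨h2 _, Gam_map ε a.2⟩
  have e2 : Gam b A ≃ₗ[R] Zb I b 0 := LinearEquiv.ofBijective
    (LinearMap.codRestrict _ (ε ∘ₗ (Gam b A).subtype) hmem) ⟨by
      intro x y hxy
      exact Subtype.ext (h1 (congrArg Subtype.val hxy)), by
      intro z
      obtain ⟨a, ha⟩ := h3 z.1 z.2.1
      refine ⟨⟨a, ?_⟩, Subtype.ext ha⟩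
      obtain ⟨n, hn⟩ := z.2.2
      refine ⟨n, fun c hc => h1 ?_⟩
      rw [map_zero, map_smul, ha, hn c hc]⟩
  exact ⟨e1.symm.trans e2.symm⟩

end T3b
end S19

namespace S19
open CategoryTheory.Limits

section TF
set_option linter.unusedSectionVars false
variable {R : Type} [CommRing R] {N : Type} [AddCommGroup N] [Module R N]
open scoped Pointwise

theorem artin_crit (x : R) (ht : ∀ y : N, ∃ k : ℕ, x ^ k • y = 0)
    (h : IsArtinian R (LinearMap.ker (x • (LinearMap.id : N →ₗ[R] N)))) : IsArtinian R N := by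
  rw [← monotone_stabilizes_iff_artinian]
  intro f
  let F : ℕ → Submodule R N := fun i => OrderDual.ofDual (f i)
  have hF : ∀ {i j}, i ≤ j → F j ≤ F i := fun hij => f.monotone hij
  let K := LinearMap.ker (x • (LinearMap.id : N →ₗ[R] N))
  let V : ℕ → ℕ → Submodule R K := fun i n =>
    ((F i).map (x ^ n • (LinearMap.id : N →ₗ[R] N))).comap K.subtype
  have hVmem : ∀ i n (z : K), z ∈ V i n ↔ ∃ y ∈ F i, x ^ n • y = z.1 := fun i n z => Iff.rfl
  have hV : ∀ {i j n l}, i ≤ j → n ≤ l → (∀ y ∈ F j, x ^ (l - n) • y ∈ F j) → V j l ≤ V i n := by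
    intro i j n l hij hnl hh z hz
    obtain ⟨y, hy, hyz⟩ := (hVmem _ _ _).1 hz
    refine (hVmem _ _ _).2 ⟨x ^ (l - n) • y, hF hij (hh y hy), ?_⟩
    rw [smul_smul, ← pow_add, Nat.add_sub_cancel' hnl, hyz]
  have hV' : ∀ {i j n l}, i ≤ j → n ≤ l → V j l ≤ V i n := fun hij hnl =>
    hV hij hnl (fun y hy => Submodule.smul_mem _ _ hy)
  have st : ∀ g : ℕ → Submodule R K, (∀ i j, i ≤ j → g j ≤ g i) → ∃ n, ∀ m, n ≤ m → g n = g m :=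
    fun g hg => monotone_stabilizes_iff_artinian.2 h ⟨fun i => OrderDual.toDual (g i), fun i j hij => hg i j hij⟩
  obtain ⟨i0, hi0⟩ := st (fun i => V i i) (fun i j hij => hV' hij hij)
  choose s hs using fun n => st (fun i => V i n) (fun i j hij => hV' hij le_rfl)
  let i1 := i0 + ∑ n ∈ Finset.range i0, s n
  have hi1 : ∀ n i, i1 ≤ i → V i1 n ≤ V i n := by
    intro n i hi
    by_cases hn : n < i0
    · have h1 : s n ≤ i1 := by
        have := Finset.single_le_sum (f := s) (fun _ _ => Nat.zero_le _) (Finset.mem_range.2 hn)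
        lia
      have e1 := hs n i1 h1
      have e2 := hs n i (h1.trans hi)
      exact (e1.symm.trans e2).le
    · push Not at hn
      have a1 : V i1 n ≤ V i0 i0 := hV' (by lia) hn
      have a2 : V i0 i0 = V (max i n) (max i n) := hi0 _ (by lia)
      exact a1.trans (a2.le.trans (hV' (le_max_left _ _) (le_max_right _ _)))
  have main : ∀ i, i1 ≤ i → ∀ n : ℕ, ∀ y ∈ F i1, x ^ n • y = 0 → y ∈ F i := by
    intro i hi n
    induction n with
    | zero =>
      intro y _ h0
      rw [pow_zero, one_smul] at h0
      rw [h0]; exact zero_mem _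
    | succ n ih =>
      intro y hy h0
      have hk : x ^ n • y ∈ K := by
        change x • x ^ n • y = 0
        rwa [smul_smul, ← pow_succ']
      obtain ⟨y', hy', e⟩ := (hVmem _ _ _).1 (hi1 n i hi ((hVmem i1 n ⟨_, hk⟩).2 ⟨y, hy, rfl⟩))
      have := ih (y - y') (Submodule.sub_mem _ hy (hF hi hy')) (by
        rw [smul_sub, e, sub_self])
      have h3 := Submodule.add_mem _ this hy'
      rwa [sub_add_cancel] at h3
  refine ⟨i1, fun i hi => ?_⟩
  refine le_antisymm (f.monotone hi) ?_
  intro y hy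
  obtain ⟨k, hk⟩ := ht y
  exact main i hi k y hy hk

variable [IsLocalRing R]

theorem artin_tors [IsArtinian R N] {x : R} (hx : x ∈ IsLocalRing.maximalIdeal R) (y : N) :
    ∃ k : ℕ, x ^ k • y = 0 := by
  obtain ⟨k, hk⟩ := monotone_stabilizes_iff_artinian.2 (inferInstance : IsArtinian R N)
    ⟨fun k => OrderDual.toDual (Submodule.span R {x ^ k • y}), by
      refine monotone_nat_of_le_succ fun n => ?_
      change Submodule.span R {x ^ (n+1) • y} ≤ Submodule.span R {x ^ n • y}
      rw [Submodule.span_singleton_le_iff_mem, pow_succ', mul_smul]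
      exact Submodule.smul_mem _ _ (Submodule.mem_span_singleton_self _)⟩
  have h1 : Submodule.span R {x ^ k • y} = Submodule.span R {x ^ (k+1) • y} := hk (k+1) (by lia)
  have h2 : x ^ k • y ∈ Submodule.span R {x ^ (k+1) • y} := h1 ▸ Submodule.mem_span_singleton_self _
  obtain ⟨c, hc⟩ := Submodule.mem_span_singleton.1 h2
  refine ⟨k, ?_⟩
  have hu : IsUnit (1 - c * x) := by
    have : c * x ∈ IsLocalRing.maximalIdeal R := Ideal.mul_mem_left _ _ hx
    by_contra hcon
    have h3 : 1 - c * x ∈ IsLocalRing.maximalIdeal R := hcon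
    have := Ideal.add_mem _ h3 this
    rw [sub_add_cancel] at this
    exact (Ideal.ne_top_iff_one _).1 (IsLocalRing.maximalIdeal.isMaximal R).ne_top this
  have h4 : (1 - c * x) • x ^ k • y = 0 := by
    rw [sub_smul, one_smul, mul_smul, smul_smul x, ← pow_succ', hc, sub_self]
  exact hu.smul_eq_zero.1 h4

theorem artin_fg [IsArtinian R N] (h : ∀ x ∈ IsLocalRing.maximalIdeal R, ∀ y : N, x • y = 0) :
    Module.Finite R N := by
  have ht : Module.IsTorsionBySet R N (IsLocalRing.maximalIdeal R : Set R) := fun y x => h x.1 x.2 y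
  let := ht.module
  have : IsScalarTower R (R ⧸ IsLocalRing.maximalIdeal R) N := ht.isScalarTower
  let : Field (R ⧸ IsLocalRing.maximalIdeal R) := Ideal.Quotient.field _
  have h1 : IsArtinian (R ⧸ IsLocalRing.maximalIdeal R) N := isArtinian_of_tower R inferInstance
  have h2 : Module.Finite (R ⧸ IsLocalRing.maximalIdeal R) N :=
    ((IsSemisimpleModule.finite_tfae (R := R ⧸ IsLocalRing.maximalIdeal R) (M := N)).out 0 2).2 h1
  exact Module.Finite.trans (R ⧸ IsLocalRing.maximalIdeal R) N

/-- good elements exist for the submodule -/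
def Goodset (B : Submodule R N) : Prop :=
  ∃ P : Set (Ideal R), P.Finite ∧ (∀ p ∈ P, p.IsPrime ∧ p ≠ IsLocalRing.maximalIdeal R) ∧
    ∀ x ∈ IsLocalRing.maximalIdeal R, (∀ p ∈ P, x ∉ p) → ∃ F : Submodule R N, F.FG ∧ B ≤ x • B ⊔ F

lemma Goodset.sup {B C : Submodule R N} (hB : Goodset B) (hC : Goodset C) : Goodset (B ⊔ C) := by
  obtain ⟨P, hP, hP1, hP2⟩ := hB
  obtain ⟨Q, hQ, hQ1, hQ2⟩ := hC
  refine ⟨P ∪ Q, hP.union hQ, ?_, ?_⟩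
  · rintro p (hp | hp)
    exacts [hP1 p hp, hQ1 p hp]
  · intro x hx hxp
    obtain ⟨F, hF, hF2⟩ := hP2 x hx (fun p hp => hxp p (Or.inl hp))
    obtain ⟨G, hG, hG2⟩ := hQ2 x hx (fun p hp => hxp p (Or.inr hp))
    refine ⟨F ⊔ G, hF.sup hG, sup_le (hF2.trans ?_) (hG2.trans ?_)⟩
    · exact sup_le_sup (Submodule.map_mono le_sup_left) le_sup_left
    · exact sup_le_sup (Submodule.map_mono le_sup_right) le_sup_right

lemma smul_pow_stab [IsArtinian R N] (B : Submodule R N) (x : R)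
    (hirr : ∀ S T : Submodule R N, B = S ⊔ T → B = S ∨ B = T) :
    x • B = B ∨ ∃ n : ℕ, ∀ y ∈ B, x ^ n • y = 0 := by
  obtain ⟨k, hk⟩ := monotone_stabilizes_iff_artinian.2 (inferInstance : IsArtinian R N)
    ⟨fun k => OrderDual.toDual (x ^ k • B), by
      refine monotone_nat_of_le_succ fun n => ?_
      change x ^ (n+1) • B ≤ x ^ n • B
      intro z hz
      obtain ⟨y, hy, rfl⟩ := (Submodule.mem_smul_pointwise_iff_exists _ _ _).1 hz
      rw [pow_succ, mul_smul]
      exact Submodule.smul_mem_pointwise_smul _ _ _ (B.smul_mem _ hy)⟩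
  have h1 : ∀ m, k ≤ m → x ^ k • B = x ^ m • B := hk
  set n := k + 1
  have e : x ^ n • B = x ^ (n + n) • B := (h1 n (by lia)).symm.trans (h1 (n+n) (by lia))
  have hdec : B = x ^ n • B ⊔ (B ⊓ LinearMap.ker (x ^ n • (LinearMap.id : N →ₗ[R] N))) := by
    apply le_antisymm
    · intro y hy
      have h2 : x ^ n • y ∈ x ^ (n+n) • B := e ▸ Submodule.smul_mem_pointwise_smul _ _ _ hy
      obtain ⟨z, hz, hzy⟩ := (Submodule.mem_smul_pointwise_iff_exists _ _ _).1 h2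
      refine Submodule.mem_sup.2 ⟨x ^ n • z, Submodule.smul_mem_pointwise_smul _ _ _ hz, y - x ^ n • z,
        ⟨B.sub_mem hy (B.smul_mem _ hz), ?_⟩, by abel⟩
      change x ^ n • (y - x ^ n • z) = 0
      rw [smul_sub, smul_smul, ← pow_add, hzy, sub_self]
    · refine sup_le ?_ inf_le_left
      intro z hz
      obtain ⟨y, hy, rfl⟩ := (Submodule.mem_smul_pointwise_iff_exists _ _ _).1 hz
      exact B.smul_mem _ hy
  rcases hirr _ _ hdec with h | h
  · left
    apply le_antisymm
    · intro z hz
      obtain ⟨y, hy, rfl⟩ := (Submodule.mem_smul_pointwise_iff_exists _ _ _).1 hz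
      exact B.smul_mem _ hy
    · intro y hy
      rw [h] at hy
      obtain ⟨z, hz, rfl⟩ := (Submodule.mem_smul_pointwise_iff_exists _ _ _).1 hy
      rw [show n = k + 1 from rfl, pow_succ', mul_smul]
      exact Submodule.smul_mem_pointwise_smul _ _ _ (B.smul_mem _ hz)
  · right
    refine ⟨n, fun y hy => ?_⟩
    rw [h] at hy
    exact hy.2

theorem good_all [IsNoetherianRing R] [IsArtinian R N] (B : Submodule R N) : Goodset B := by
  induction B using IsArtinian.induction with
  | _ B ih =>
  by_cases hirr : ∀ S T : Submodule R N, B = S ⊔ T → B = S ∨ B = T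
  swap
  · push Not at hirr
    obtain ⟨S, T, h, hS, hT⟩ := hirr
    rw [h]
    exact (ih S (lt_of_le_of_ne (h ▸ le_sup_left) hS.symm)).sup
      (ih T (lt_of_le_of_ne (h ▸ le_sup_right) hT.symm))
  by_cases hmB : IsLocalRing.maximalIdeal R • B = B
  · by_cases h0 : B = ⊥
    · exact ⟨∅, Set.finite_empty, by simp, fun x _ _ => ⟨⊥, Submodule.fg_bot, by rw [h0]; exact bot_le⟩⟩
    let p := B.annihilator.radical
    have hp : ∀ x, x ∉ p → x • B = B := by
      intro x hx
      rcases smul_pow_stab B x hirr with h | ⟨n, hn⟩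
      · exact h
      · exact (hx ⟨n, Submodule.mem_annihilator.2 hn⟩).elim
    have hpp : p.IsPrime := by
      refine ⟨?_, ?_⟩
      · intro htop
        rw [Ideal.radical_eq_top] at htop
        exact h0 (Submodule.annihilator_eq_top_iff.1 htop)
      · intro x y hxy
        by_contra hcon
        push Not at hcon
        obtain ⟨n, hn⟩ := hxy
        have hpow : ∀ n : ℕ, (x * y) ^ n • B = B := by
          intro n
          induction n with
          | zero => simp
          | succ n ih => rw [pow_succ', mul_smul, ih, mul_smul, hp y hcon.2, hp x hcon.1]
        apply h0
        rw [← hpow n, eq_bot_iff]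
        intro z hz
        obtain ⟨w, hw, rfl⟩ := (Submodule.mem_smul_pointwise_iff_exists _ _ _).1 hz
        exact Submodule.mem_annihilator.1 hn w hw
    have hpm : p ≠ IsLocalRing.maximalIdeal R := by
      intro hpm
      obtain ⟨t, ht⟩ := Ideal.exists_pow_le_of_le_radical_of_fg hpm.symm.le (IsNoetherian.noetherian _)
      have hpow : ∀ n : ℕ, (IsLocalRing.maximalIdeal R) ^ n • B = B := by
        intro n
        induction n with
        | zero => simp
        | succ n ih => rw [pow_succ, Submodule.mul_smul, hmB, ih]
      apply h0
      rw [← hpow t, eq_bot_iff, Submodule.smul_le]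
      intro r hr y hy
      exact Submodule.mem_annihilator.1 (ht hr) y hy
    refine ⟨{p}, Set.finite_singleton _, ?_, ?_⟩
    · rintro _ rfl; exact ⟨hpp, hpm⟩
    · intro x _ hxp
      exact ⟨⊥, Submodule.fg_bot, by rw [hp x (hxp p rfl)]; exact le_sup_left⟩
  · have hlt : IsLocalRing.maximalIdeal R • B < B := lt_of_le_of_ne Submodule.smul_le_right hmB
    obtain ⟨P, hP, hP1, hP2⟩ := ih _ hlt
    refine ⟨P, hP, hP1, fun x hx hxp => ?_⟩
    obtain ⟨F, hF, hF2⟩ := hP2 x hx hxp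
    set C := (IsLocalRing.maximalIdeal R • B) with hC
    let q : B →ₗ[R] N ⧸ C := C.mkQ ∘ₗ B.subtype
    have : IsArtinian R (LinearMap.range q) := inferInstance
    have hfin : Module.Finite R (LinearMap.range q) := by
      apply artin_fg
      rintro x hx ⟨_, y, rfl⟩
      apply Subtype.ext
      change x • C.mkQ y.1 = 0
      rw [← map_smul, ← LinearMap.mem_ker, Submodule.ker_mkQ]
      exact Submodule.smul_mem_smul hx y.2
    have hfg : (Submodule.map C.mkQ B).FG := by
      have e : LinearMap.range q = Submodule.map C.mkQ B := by
        rw [LinearMap.range_comp, Submodule.range_subtype]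
      rw [← e]
      exact Module.Finite.iff_fg.1 hfin
    obtain ⟨G, hG1, hG2⟩ : ∃ G : Submodule R N, G.FG ∧ Submodule.map C.mkQ G = Submodule.map C.mkQ B := by
      classical
      obtain ⟨s, hs⟩ := hfg
      choose o ho using Submodule.mkQ_surjective C
      refine ⟨Submodule.span R (s.image o : Finset N), ⟨_, rfl⟩, ?_⟩
      rw [← hs, Submodule.map_span, Finset.coe_image, Set.image_image]
      congr 1
      simp [ho]
    refine ⟨F ⊔ G, hF.sup hG1, ?_⟩
    intro y hy
    have : C.mkQ y ∈ Submodule.map C.mkQ G := by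
      rw [hG2]; exact ⟨y, hy, rfl⟩
    obtain ⟨g, hg, hgy⟩ := this
    have hc : y - g ∈ C := by
      rw [← Submodule.ker_mkQ C, LinearMap.mem_ker, map_sub, hgy, sub_self]
    have h5 := hF2 hc
    have h8 : x • C ⊔ F ≤ x • B ⊔ (F ⊔ G) :=
      sup_le_sup (Submodule.map_mono hlt.le) le_sup_left
    have h6 : y - g ∈ x • B ⊔ (F ⊔ G) := h8 h5
    have h7 := Submodule.add_mem _ h6 (Submodule.mem_sup_right (Submodule.mem_sup_right hg))
    rwa [sub_add_cancel] at h7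

end TF
end S19

namespace S19
open CategoryTheory.Limits

section TG
set_option linter.unusedSectionVars false
variable {R : Type} [CommRing R] [IsNoetherianRing R]

lemma D_subsing (b : Ideal R) (i : ℕ) (A : Type) [AddCommGroup A] [Module R A] [Subsingleton A] :
    Subsingleton (D b i A) := by
  refine subsingleton_of_forall_eq 0 fun z => ?_
  have : (LinearMap.id : A →ₗ[R] A) = 0 := LinearMap.ext fun a => Subsingleton.elim _ _
  rw [← Dm_id b i z, this, Dm_zero]

/-- short exact sequence of multiplication by x -/
lemma mul_les (b : Ideal R) (i : ℕ) (A : Type) [AddCommGroup A] [Module R A] (x : R)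
    (hx : Function.Injective (x • (LinearMap.id : A →ₗ[R] A))) :
    ∃ (g : D b i A →ₗ[R] D b i (A ⧸ LinearMap.range (x • (LinearMap.id : A →ₗ[R] A))))
      (δ : D b i (A ⧸ LinearMap.range (x • (LinearMap.id : A →ₗ[R] A))) →ₗ[R] D b (i+1) A),
      (∀ z, g z = 0 ↔ ∃ w, x • w = z) ∧ (∀ z, δ z = 0 ↔ ∃ w, g w = z) ∧
      (∀ z, x • z = 0 ↔ ∃ w, δ w = z) := by
  obtain ⟨δ, h1, h2, h3⟩ := les b i (x • (LinearMap.id : A →ₗ[R] A))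
    (LinearMap.range (x • (LinearMap.id : A →ₗ[R] A))).mkQ hx
    (LinearMap.exact_iff.2 (Submodule.ker_mkQ _)) (Submodule.mkQ_surjective _)
  refine ⟨Dm b i _, δ, fun z => ?_, fun z => h2 z, fun z => ?_⟩
  · refine (h1 z).trans (exists_congr fun w => ?_)
    rw [Dm_smul_id]
  · refine Iff.trans ?_ (h3 z)
    rw [Dm_smul_id]

variable [IsLocalRing R]
local notation "𝔪" => IsLocalRing.maximalIdeal R

lemma ker_smul_artin (b : Ideal R) (i : ℕ) (A : Type) [AddCommGroup A] [Module R A] (x : R)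
    (hxb : x ∈ b) (h : IsArtinian R (LinearMap.ker (x • (LinearMap.id : D b i A →ₗ[R] D b i A)))) :
    IsArtinian R (D b i A) :=
  artin_crit x (fun y => Gam_pow hxb (Dtors A b i y)) h

theorem F2 (i : ℕ) : ∀ (A : Type) [AddCommGroup A] [Module R A] [Module.Finite R A],
    IsArtinian R (D 𝔪 i A) := by
  induction i with
  | zero =>
    intro A _ _ hA
    refine IsNoetherianRing.induction_on_isQuotientEquivQuotientPrime R hA
      (motive := fun N _ _ _ => IsArtinian R (D 𝔪 0 N)) ?_ ?_ ?_
    · intro N _ _ _ _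
      have := D_subsing 𝔪 0 N (R := R)
      infer_instance
    · intro N _ _ _ p e
      suffices h : IsArtinian R (D 𝔪 0 (R ⧸ p.asIdeal)) from
        isArtinian_of_linearEquiv (Dcongr 𝔪 0 e).symm
      by_cases hp : 𝔪 ≤ p.asIdeal
      · have hp' : p.asIdeal = 𝔪 := ((IsLocalRing.maximalIdeal.isMaximal R).eq_of_le p.2.ne_top hp).symm
        have : IsArtinian R (R ⧸ p.asIdeal) := by
          have : p.asIdeal.IsMaximal := by rw [hp']; infer_instance
          have : IsSimpleModule R (R ⧸ p.asIdeal) := (isSimpleModule_iff_isCoatom).2 this.out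
          infer_instance
        obtain ⟨e⟩ := D0 (R ⧸ p.asIdeal) 𝔪
        exact isArtinian_of_linearEquiv e.symm
      · obtain ⟨x, hx, hxp⟩ := SetLike.not_le_iff_exists.1 hp
        refine ker_smul_artin _ _ _ x hx ?_
        have hinj : Function.Injective (x • (LinearMap.id : (R ⧸ p.asIdeal) →ₗ[R] _)) := by
          rw [injective_iff_map_eq_zero]
          intro a ha
          obtain ⟨a, rfl⟩ := Submodule.Quotient.mk_surjective _ a
          have h2 : Submodule.Quotient.mk (p := p.asIdeal) (x * a) = 0 := ha
          rw [Submodule.Quotient.mk_eq_zero] at h2 ⊢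
          exact (p.2.mem_or_mem h2).resolve_left hxp
        have h3 := Dm0_inj 𝔪 _ hinj
        have : Subsingleton (LinearMap.ker (x • (LinearMap.id : D 𝔪 0 (R ⧸ p.asIdeal) →ₗ[R] _))) := by
          refine subsingleton_of_forall_eq 0 fun z => Subtype.ext (h3 ?_)
          refine Eq.trans (Dm_smul_id _ _ _ _) (Eq.trans z.2 (map_zero _).symm)
        infer_instance
    · intro N₁ _ _ _ N₂ _ _ _ N₃ _ _ _ f g hf hg hfg h1 h3
      obtain ⟨δ, e1, -, -⟩ := les 𝔪 0 f g hf hfg hg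
      exact isArtinian_of_range_eq_ker (Dm 𝔪 0 f) (Dm 𝔪 0 g) (LinearMap.exact_iff.1 e1).symm
  | succ i ih =>
    intro A _ _ hA
    refine IsNoetherianRing.induction_on_isQuotientEquivQuotientPrime R hA
      (motive := fun N _ _ _ => IsArtinian R (D 𝔪 (i+1) N)) ?_ ?_ ?_
    · intro N _ _ _ _
      have := D_subsing 𝔪 (i+1) N (R := R)
      infer_instance
    · intro N _ _ _ p e
      suffices h : IsArtinian R (D 𝔪 (i+1) (R ⧸ p.asIdeal)) from
        isArtinian_of_linearEquiv (Dcongr 𝔪 (i+1) e).symm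
      by_cases hp : 𝔪 ≤ p.asIdeal
      · have := lemV_tors (R ⧸ p.asIdeal) i 𝔪 (fun x hx => ⟨1, fun a => by
          obtain ⟨a, rfl⟩ := Submodule.Quotient.mk_surjective _ a
          rw [pow_one, ← Submodule.Quotient.mk_smul, Submodule.Quotient.mk_eq_zero]
          exact Ideal.mul_mem_right _ _ (hp hx)⟩)
        infer_instance
      · obtain ⟨x, hx, hxp⟩ := SetLike.not_le_iff_exists.1 hp
        refine ker_smul_artin _ _ _ x hx ?_
        have hinj : Function.Injective (x • (LinearMap.id : (R ⧸ p.asIdeal) →ₗ[R] _)) := by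
          rw [injective_iff_map_eq_zero]
          intro a ha
          obtain ⟨a, rfl⟩ := Submodule.Quotient.mk_surjective _ a
          have h2 : Submodule.Quotient.mk (p := p.asIdeal) (x * a) = 0 := ha
          rw [Submodule.Quotient.mk_eq_zero] at h2 ⊢
          exact (p.2.mem_or_mem h2).resolve_left hxp
        obtain ⟨g, δ, -, -, h3⟩ := mul_les 𝔪 i (R ⧸ p.asIdeal) x hinj
        have ha := ih ((R ⧸ p.asIdeal) ⧸ LinearMap.range (x • (LinearMap.id : (R ⧸ p.asIdeal) →ₗ[R] _)))
        have : LinearMap.ker (x • (LinearMap.id : D 𝔪 (i+1) (R ⧸ p.asIdeal) →ₗ[R] _)) =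
            LinearMap.range δ := by
          ext z
          exact h3 z
        rw [this]
        infer_instance
    · intro N₁ _ _ _ N₂ _ _ _ N₃ _ _ _ f g hf hg hfg h1 h3
      obtain ⟨δ, e1, -, -⟩ := les 𝔪 (i+1) f g hf hfg hg
      exact isArtinian_of_range_eq_ker (Dm 𝔪 (i+1) f) (Dm 𝔪 (i+1) g) (LinearMap.exact_iff.1 e1).symm

variable (A : Type) [AddCommGroup A] [Module R A] [Module.Finite R A]

theorem q_prime (r : ℕ) (q : Ideal R) (hq : ∃ i, r ≤ i ∧ ¬ IsArtinian R (D q i A))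
    (hmax : ∀ b : Ideal R, q ≤ b → b ≠ q → ∀ i, r ≤ i → IsArtinian R (D b i A)) : q.IsPrime := by
  obtain ⟨i, hri, hi⟩ := hq
  have hne : q ≠ ⊤ := by
    rintro rfl
    apply hi
    have : Subsingleton (D (⊤ : Ideal R) i A) := subsingleton_of_forall_eq 0 fun y => by
      obtain ⟨k, hk⟩ := Gam_pow (x := (1:R)) Submodule.mem_top (Dtors A (⊤ : Ideal R) i y)
      rwa [one_pow, one_smul] at hk
    infer_instance
  refine ⟨hne, ?_⟩
  have hadj : ∀ x, x ∉ q → IsArtinian R (Gam (Ideal.span {x}) (D q i A)) := by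
    intro x hx
    refine alpha A q x i (hmax _ le_sup_left (fun h => hx ?_) i hri)
    rw [← h]
    exact Ideal.mem_sup_right (Ideal.mem_span_singleton_self x)
  intro x y hxy
  by_cases hxu : IsUnit x
  · right
    exact (Ideal.unit_mul_mem_iff_mem q hxu).1 hxy
  by_contra hcon
  push Not at hcon
  have ax := hadj x hcon.1
  have ay := hadj y hcon.2
  apply hi
  have htop : Gam (Ideal.span {x}) (D q i A) = ⊤ := by
    rw [eq_top_iff]
    intro h _
    obtain ⟨n, hn⟩ := Gam_pow hxy (Dtors A q i h)
    have h1 : x ^ n • h ∈ Gam (Ideal.span {y}) (D q i A) := by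
      rw [Gam_span]
      exact ⟨n, by rw [smul_smul, ← mul_pow, mul_comm, hn]⟩
    obtain ⟨k, hk⟩ := artin_tors (show x ∈ 𝔪 from hxu) (⟨_, h1⟩ : Gam (Ideal.span {y}) (D q i A))
    rw [Gam_span]
    refine ⟨k + n, ?_⟩
    rw [pow_add, mul_smul]
    exact congrArg Subtype.val hk
  rw [htop] at ax
  exact isArtinian_of_linearEquiv (Submodule.topEquiv)

end TG
end S19

namespace S19
open CategoryTheory.Limits

section TH
set_option linter.unusedSectionVars false
variable {R : Type} [CommRing R] [IsNoetherianRing R]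

theorem ext_artin (X T : ModuleCat.{0} R) [Module.Finite R X] [IsArtinian R T] (i : ℕ) :
    IsArtinian R (Abelian.Ext X T i) := by
  induction i generalizing X with
  | zero =>
    have h : IsArtinian R (X →ₗ[R] T) := by
      obtain ⟨n, f, hf⟩ := Module.Finite.exists_fin' R X
      let ev : (X →ₗ[R] T) →ₗ[R] (Fin n → T) :=
        LinearMap.pi fun j => LinearMap.applyₗ (f (Pi.single j 1))
      refine isArtinian_of_injective ev ?_
      intro g h hgh
      have : g ∘ₗ f = h ∘ₗ f := by
        refine LinearMap.pi_ext' fun j => LinearMap.ext_ring ?_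
        exact congrFun hgh j
      refine LinearMap.ext fun x => ?_
      obtain ⟨y, rfl⟩ := hf x
      exact LinearMap.congr_fun this y
    exact isArtinian_of_linearEquiv (Abelian.Ext.linearEquiv₀.trans ModuleCat.homLinearEquiv).symm
  | succ n ih =>
    obtain ⟨P, _, _, _, _, f, surjf⟩ := Module.exists_finite_presentation R X
    let exac := LinearMap.shortExact_shortComplexKer surjf
    have := ih (LinearMap.shortComplexKer f).X₁
    exact isArtinian_of_surjective _ (exac.extClass.precompOfLinear R T (add_comm 1 n))
      (precomp_extClass_surjective_of_projective_X₂ T exac n)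

lemma ext_mid (X : ModuleCat.{0} R) {A B C : Type} [AddCommGroup A] [Module R A] [AddCommGroup B]
    [Module R B] [AddCommGroup C] [Module R C]
    (j : ℕ) (f : A →ₗ[R] B) (g : B →ₗ[R] C) (hf : Function.Injective f)
    (hfg : Function.Exact f g) (hg : Function.Surjective g) :
    Function.Exact
      ((Abelian.Ext.mk₀ (ModuleCat.ofHom f)).postcompOfLinear R X (add_zero j))
      ((Abelian.Ext.mk₀ (ModuleCat.ofHom g)).postcompOfLinear R X (add_zero j)) := by
  let S : ShortComplex (ModuleCat.{0} R) := ShortComplex.mk (ModuleCat.ofHom f) (ModuleCat.ofHom g)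
    (by ext x; exact hfg.apply_apply_eq_zero x)
  have hS : S.ShortExact := ModuleCat.shortComplex_shortExact S hfg hf hg
  intro e
  constructor
  · intro he
    exact Abelian.Ext.covariant_sequence_exact₂ X hS e he
  · rintro ⟨e, rfl⟩
    have h := S.zero
    change (e.comp (Abelian.Ext.mk₀ S.f) (add_zero j)).comp (Abelian.Ext.mk₀ S.g) (add_zero j) = 0
    rw [Abelian.Ext.comp_assoc_of_second_deg_zero, Abelian.Ext.mk₀_comp_mk₀, h, Abelian.Ext.mk₀_zero,
      Abelian.Ext.comp_zero]

variable [IsLocalRing R]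
local notation "𝔪" => IsLocalRing.maximalIdeal R

variable (R) in
/-- residue field module -/
abbrev kk : ModuleCat.{0} R := ModuleCat.of R (R ⧸ IsLocalRing.maximalIdeal R)

lemma ext_kill (Y : ModuleCat.{0} R) (j : ℕ) (x : R) (hx : x ∈ 𝔪) (e : Abelian.Ext (kk R) Y j) :
    x • e = 0 := by
  have h : x • 𝟙 (kk R) = 0 := by
    apply ModuleCat.hom_ext
    refine LinearMap.ext fun a => ?_
    obtain ⟨a, rfl⟩ := Submodule.Quotient.mk_surjective _ a
    change x • Submodule.Quotient.mk (p := IsLocalRing.maximalIdeal R) a = 0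
    rw [← Submodule.Quotient.mk_smul, Submodule.Quotient.mk_eq_zero]
    exact Ideal.mul_mem_right _ _ hx
  have smul_eq : x • e = (Abelian.Ext.mk₀ (x • 𝟙 (kk R))).comp e (zero_add j) := by
    simp [Abelian.Ext.mk₀_smul]
  rw [smul_eq, h, Abelian.Ext.mk₀_zero, Abelian.Ext.zero_comp]

lemma ext_fin (T : Type) [AddCommGroup T] [Module R T] [IsArtinian R T] (j : ℕ) :
    Module.Finite R (Abelian.Ext (kk R) (ModuleCat.of R T) j) := by
  have := ext_artin (kk R) (ModuleCat.of R T) j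
  exact artin_fg (fun x hx e => ext_kill _ j x hx e)

theorem bass (H : Type) [AddCommGroup H] [Module R H] (x : R) (hx : x ∈ 𝔪)
    (h1 : IsArtinian R (Gam (Ideal.span {x}) H))
    (h2 : IsArtinian R (H ⧸ (Gam (Ideal.span {x}) H ⊔ LinearMap.range (x • (LinearMap.id : H →ₗ[R] H)))))
    (j : ℕ) : Module.Finite R (Abelian.Ext (kk R) (ModuleCat.of R H) j) := by
  set G := Gam (Ideal.span {x}) H with hG
  let X := x • (LinearMap.id : (H ⧸ G) →ₗ[R] (H ⧸ G))
  have hinj : Function.Injective X := by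
    rw [injective_iff_map_eq_zero]
    intro a ha
    obtain ⟨a, rfl⟩ := Submodule.Quotient.mk_surjective _ a
    have ha' : Submodule.Quotient.mk (p := G) (x • a) = 0 := ha
    rw [Submodule.Quotient.mk_eq_zero] at ha' ⊢
    obtain ⟨k, hk⟩ := Gam_span.1 ha'
    refine Gam_span.2 ⟨k + 1, ?_⟩
    rw [pow_succ, mul_smul, hk]
  have hQ : IsArtinian R ((H ⧸ G) ⧸ LinearMap.range X) := by
    refine isArtinian_of_surjective (H ⧸ (G ⊔ LinearMap.range (x • (LinearMap.id : H →ₗ[R] H))))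
      (Submodule.liftQ _ ((LinearMap.range X).mkQ ∘ₗ G.mkQ) ?_) ?_
    · refine sup_le ?_ ?_
      · intro g hg
        change (LinearMap.range X).mkQ (G.mkQ g) = 0
        have : G.mkQ g = 0 := by rwa [← LinearMap.mem_ker, Submodule.ker_mkQ]
        rw [this, map_zero]
      · rintro _ ⟨y, rfl⟩
        change (LinearMap.range X).mkQ (G.mkQ (x • y)) = 0
        rw [← LinearMap.mem_ker, Submodule.ker_mkQ]
        exact ⟨G.mkQ y, rfl⟩
    · intro y
      obtain ⟨z, rfl⟩ := Submodule.mkQ_surjective _ y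
      obtain ⟨w, rfl⟩ := Submodule.mkQ_surjective _ z
      exact ⟨Submodule.Quotient.mk w, rfl⟩
  have f1 := ext_fin (R := R) G j
  have f2 := ext_fin (R := R) ((H ⧸ G) ⧸ LinearMap.range X) j
  have e2 := ext_mid (kk R) j X (LinearMap.range X).mkQ hinj
    (LinearMap.exact_iff.2 (Submodule.ker_mkQ _)) (Submodule.mkQ_surjective _)
  have f3 : Module.Finite R (Abelian.Ext (kk R) (ModuleCat.of R (H ⧸ G)) j) := by
    refine Module.Finite.of_injective
      ((Abelian.Ext.mk₀ (ModuleCat.ofHom (LinearMap.range X).mkQ)).postcompOfLinear R (kk R) (add_zero j)) ?_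
    rw [injective_iff_map_eq_zero]
    intro e he
    obtain ⟨e', rfl⟩ := (e2 e).1 he
    have : ModuleCat.ofHom X = x • 𝟙 (ModuleCat.of R (H ⧸ G)) := rfl
    change e'.comp (Abelian.Ext.mk₀ (ModuleCat.ofHom X)) (add_zero j) = 0
    rw [this, ← Abelian.Ext.smul_eq_comp_mk₀]
    exact ext_kill _ j x hx e'
  have e1 := ext_mid (kk R) j G.subtype G.mkQ Subtype.val_injective
    (LinearMap.exact_iff.2 (by rw [Submodule.ker_mkQ, Submodule.range_subtype])) (Submodule.mkQ_surjective _)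
  have n1 := isNoetherian_of_isNoetherianRing_of_finite R (Abelian.Ext (kk R) (ModuleCat.of R G) j)
  have n3 := isNoetherian_of_isNoetherianRing_of_finite R (Abelian.Ext (kk R) (ModuleCat.of R (H ⧸ G)) j)
  have := isNoetherian_of_range_eq_ker _ _ (LinearMap.exact_iff.1 e1).symm
  infer_instance

theorem bass_q (A : Type) [AddCommGroup A] [Module R A] [Module.Finite R A]
    (r : ℕ) (q : Ideal R) (hq : ∃ i, r ≤ i ∧ ¬ IsArtinian R (D q i A)) (hp : q.IsPrime)
    (hmax : ∀ b : Ideal R, q ≤ b → b ≠ q → ∀ i, r ≤ i → IsArtinian R (D b i A))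
    (j i : ℕ) (hi : r ≤ i) : Module.Finite R (Abelian.Ext (kk R) (ModuleCat.of R (D q i A)) j) := by
  have hqm : ¬ 𝔪 ≤ q := by
    intro h
    have : q = 𝔪 := ((IsLocalRing.maximalIdeal.isMaximal R).eq_of_le hp.ne_top h).symm
    obtain ⟨i, _, h2⟩ := hq
    apply h2
    rw [this]
    exact F2 i A
  obtain ⟨x, hx, hxq⟩ := SetLike.not_le_iff_exists.1 hqm
  have hne : adj q x ≠ q := by
    intro h
    apply hxq
    rw [← h]
    exact Ideal.mem_sup_right (Ideal.mem_span_singleton_self x)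
  exact bass _ x hx (alpha A q x i (hmax _ le_sup_left hne i hi))
    (beta A q x i (hmax _ le_sup_left hne (i+1) (by lia))) j

end TH
end S19

namespace S19
open CategoryTheory.Limits

section TI
set_option linter.unusedSectionVars false
open scoped Pointwise
variable {R : Type} [CommRing R] [IsNoetherianRing R]

lemma Gam_unif (b : Ideal R) (A : Type) [AddCommGroup A] [Module R A] [Module.Finite R A] :
    ∃ l : ℕ, ∀ y ∈ Gam b A, ∀ c ∈ b ^ l, c • y = 0 := by
  have : IsNoetherian R A := isNoetherian_of_isNoetherianRing_of_finite R A
  let f : ℕ →o Submodule R A :=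
    ⟨fun l => Submodule.torsionBySet R A (b ^ l : Ideal R), fun i j h =>
      Submodule.torsionBySet_le_torsionBySet_of_subset (Ideal.pow_le_pow_right h)⟩
  obtain ⟨l, hl⟩ := monotone_stabilizes_iff_noetherian.2 this f
  refine ⟨l, fun y hy c hc => ?_⟩
  obtain ⟨n, hn⟩ := mem_Gam.1 hy
  have h1 : y ∈ f (max l n) := by
    refine (Submodule.mem_torsionBySet_iff _ _).2 fun a => hn _ (Ideal.pow_le_pow_right (le_max_right l n) a.2)
  rw [← hl _ (le_max_left l n)] at h1
  exact (Submodule.mem_torsionBySet_iff _ _).1 h1 ⟨c, hc⟩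

lemma Gam_quot (b : Ideal R) (A : Type) [AddCommGroup A] [Module R A] [Module.Finite R A] :
    Gam b (A ⧸ Gam b A) = ⊥ := by
  rw [eq_bot_iff]
  intro y hy
  obtain ⟨l, hl⟩ := Gam_unif b A
  obtain ⟨k, hk⟩ := mem_Gam.1 hy
  obtain ⟨a, rfl⟩ := Submodule.Quotient.mk_surjective _ y
  rw [Submodule.mem_bot, Submodule.Quotient.mk_eq_zero, mem_Gam]
  refine ⟨l + k, ?_⟩
  have : b ^ (l + k) ≤ LinearMap.ker (LinearMap.toSpanSingleton R A a) := by
    rw [pow_add, Ideal.mul_le]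
    intro c hc d hd
    rw [LinearMap.mem_ker, LinearMap.toSpanSingleton_apply, mul_smul]
    refine hl _ ?_ c hc
    rw [← Submodule.Quotient.mk_eq_zero, Submodule.Quotient.mk_smul]
    exact hk d hd
  intro c hc
  exact this hc

variable [IsLocalRing R]
local notation "𝔪" => IsLocalRing.maximalIdeal R

lemma dim_quot (A : Type) [AddCommGroup A] [Module R A] [Module.Finite R A] (n : ℕ)
    (h : Module.supportDim R A = (n + 1 : ℕ)) :
    Module.supportDim R (A ⧸ Gam 𝔪 A) = (n + 1 : ℕ) := by
  refine le_antisymm (h ▸ Module.supportDim_le_of_surjective _ (Submodule.mkQ_surjective _)) ?_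
  obtain ⟨s, hs⟩ := Order.le_krullDim_iff.1 (show ((n + 1 : ℕ) : WithBot ℕ∞) ≤ Order.krullDim (Module.support R A) from h.ge)
  have hexact : Function.Exact (Gam 𝔪 A).subtype (Gam 𝔪 A).mkQ :=
    LinearMap.exact_subtype_mkQ _
  have hsup := Module.support_of_exact hexact (Submodule.subtype_injective _) (Submodule.mkQ_surjective _)
  have h0 : s.head.1 ∈ Module.support R (A ⧸ Gam 𝔪 A) := by
    have h1 : s.head.1 ∈ Module.support R A := s.head.2
    have h1 := hsup.le h1
    refine h1.resolve_left fun h2 => ?_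
    obtain ⟨w, hw⟩ := Module.mem_support_iff'.1 h2
    have hle : 𝔪 ≤ s.head.1.asIdeal := by
      intro x hx
      by_contra hxp
      obtain ⟨k, hk⟩ := Gam_pow hx w.2
      refine hw (x ^ k) (fun h3 => hxp (s.head.1.2.mem_of_pow_mem k h3)) (Subtype.ext hk)
    have hlt : s.head < s.last := by
      refine s.strictMono ?_
      rw [Fin.lt_def]; simp [hs]
    have h4 : s.head.1.asIdeal < s.last.1.asIdeal := hlt
    exact absurd (h4.trans_le (IsLocalRing.le_maximalIdeal s.last.1.2.ne_top)) (not_lt_of_ge hle)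
  refine Order.le_krullDim_iff.2 ⟨⟨s.length, fun i => ⟨(s i).1, Module.mem_support_mono (s.head_le i) h0⟩, fun i => s.step i⟩, hs⟩

lemma tors_of_dim_zero (B : Type) [AddCommGroup B] [Module R B] [Module.Finite R B]
    (h : Module.supportDim R B = 0) : 𝔪 ≤ (Module.annihilator R B).radical := by
  have h1 := support_of_supportDim_eq_zero R B h
  rw [Module.support_eq_zeroLocus] at h1
  have := PrimeSpectrum.zeroLocus_subset_zeroLocus_iff _ _ |>.1 h1.le
  exact this

lemma fin_ses {X Y Z : Type} [AddCommGroup X] [Module R X] [AddCommGroup Y] [Module R Y]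
    [AddCommGroup Z] [Module R Z] (g : X →ₗ[R] Y) (δ : Y →ₗ[R] Z) (h : ∀ y, δ y = 0 ↔ ∃ w, g w = y)
    (hg : (LinearMap.range g).FG) [Module.Finite R Z] : Module.Finite R Y := by
  have : IsNoetherian R Z := isNoetherian_of_isNoetherianRing_of_finite R Z
  refine ⟨Submodule.fg_of_fg_map_of_fg_inf_ker δ (IsNoetherian.noetherian _) ?_⟩
  rw [top_inf_eq]
  have he : LinearMap.ker δ = LinearMap.range g := Submodule.ext h
  rw [he]
  exact hg


lemma NVaux (n : ℕ) (N : Type) [AddCommGroup N] [Module R N] [Module.Finite R N]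
    (hG : Gam 𝔪 N = ⊥) (hN : Module.supportDim R N = (n + 1 : ℕ)) (hfin : Module.Finite R (D 𝔪 (n+1) N)) :
    ∃ x ∈ 𝔪, Function.Injective (x • (LinearMap.id : N →ₗ[R] N)) ∧
      Module.supportDim R (N ⧸ LinearMap.range (x • (LinearMap.id : N →ₗ[R] N))) = n ∧
      Module.Finite R (D 𝔪 n (N ⧸ LinearMap.range (x • (LinearMap.id : N →ₗ[R] N)))) := by
  have hart := F2 (R := R) n N
  obtain ⟨P, hP, hP1, hP2⟩ := good_all (⊤ : Submodule R (D 𝔪 n N))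
  have hass : ∀ p ∈ associatedPrimes R N, p.IsPrime ∧ p ≠ 𝔪 := by
    intro p hp
    refine ⟨hp.1, ?_⟩
    rintro rfl
    obtain ⟨-, f, hf⟩ := (isAssociatedPrime_iff_exists_injective_linearMap _ _).1 hp
    have h1 : f (Submodule.Quotient.mk 1) ∈ Gam 𝔪 N := by
      refine mem_Gam.2 ⟨1, fun a ha => ?_⟩
      rw [pow_one] at ha
      rw [← map_smul, ← Submodule.Quotient.mk_smul, (Submodule.Quotient.mk_eq_zero _).2, map_zero]
      simpa using ha
    rw [hG, Submodule.mem_bot, ← map_zero f] at h1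
    have h2 := (Submodule.Quotient.mk_eq_zero _).1 (hf h1)
    exact (Ideal.ne_top_iff_one _).1 (IsLocalRing.maximalIdeal.isMaximal R).ne_top h2
  have hfinU : (P ∪ associatedPrimes R N).Finite := hP.union (associatedPrimes.finite R N)
  have hall : ∀ p ∈ P ∪ associatedPrimes R N, p.IsPrime ∧ p ≠ 𝔪 := by
    rintro p (hp | hp)
    exacts [hP1 p hp, hass p hp]
  have hex : ∃ x ∈ 𝔪, ∀ p ∈ P ∪ associatedPrimes R N, x ∉ p := by
    by_contra hcon
    push Not at hcon
    have hsub : ((𝔪 : Ideal R) : Set R) ⊆ ⋃ p ∈ P ∪ associatedPrimes R N, ((id p : Ideal R) : Set R) := by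
      intro x hx
      obtain ⟨p, hp, hxp⟩ := hcon x hx
      exact Set.mem_biUnion hp hxp
    obtain ⟨p, hp, hle⟩ := (Ideal.subset_union_prime_finite hfinU (f := id) 0 0
      (fun p hp _ _ => (hall p hp).1)).1 hsub
    exact (hall p hp).2 ((IsLocalRing.maximalIdeal.isMaximal R).eq_of_le (hall p hp).1.ne_top hle).symm
  obtain ⟨x, hx, hxp⟩ := hex
  have hreg : IsSMulRegular N x := by
    by_contra hcon
    have h1 : x ∈ ({r | IsSMulRegular N r}ᶜ : Set R) := hcon
    rw [← biUnion_associatedPrimes_eq_compl_regular R N] at h1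
    obtain ⟨p, hp, h2⟩ := Set.mem_iUnion₂.1 h1
    exact hxp p (Or.inr hp) h2
  have hinj : Function.Injective (x • (LinearMap.id : N →ₗ[R] N)) := hreg
  refine ⟨x, hx, hinj, ?_, ?_⟩
  · have h1 := Module.supportDim_quotSMulTop_succ_eq_supportDim hreg hx
    have he : (x • (⊤ : Submodule R N)) = LinearMap.range (x • (LinearMap.id : N →ₗ[R] N)) := by
      ext z
      simp [Submodule.mem_smul_pointwise_iff_exists]
    rw [hN, Module.supportDim_eq_of_equiv (Submodule.quotEquivOfEq _ _ he)] at h1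
    generalize Module.supportDim R (N ⧸ LinearMap.range (x • (LinearMap.id : N →ₗ[R] N))) = t at h1
    cases t with
    | bot => rw [WithBot.bot_add] at h1; exact absurd h1.symm (WithBot.natCast_ne_bot _)
    | coe t =>
      cases t with
      | top => exact absurd h1 (by exact_mod_cast ENat.top_ne_natCast _)
      | coe t =>
        norm_cast at h1 ⊢
        omega
  · obtain ⟨g, δ, hg, hδ, -⟩ := mul_les 𝔪 n N x hinj
    obtain ⟨F, hF, hF2⟩ := hP2 x hx fun p hp => hxp p (Or.inl hp)
    refine fin_ses g δ hδ ?_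
    have he : LinearMap.range g = F.map g := by
      refine le_antisymm ?_ (LinearMap.map_le_range)
      rintro _ ⟨z, rfl⟩
      obtain ⟨u, hu, v, hv, rfl⟩ := Submodule.mem_sup.1 (hF2 (Submodule.mem_top (x := z)))
      obtain ⟨w, -, rfl⟩ := (Submodule.mem_smul_pointwise_iff_exists _ _ _).1 hu
      rw [map_add, (hg _).2 ⟨w, rfl⟩, zero_add]
      exact Submodule.mem_map_of_mem hv
    rw [he]
    exact hF.map g

lemma NVstep (n : ℕ) (A : Type) [AddCommGroup A] [Module R A] [Module.Finite R A]
    (hA : Module.supportDim R A = (n + 1 : ℕ)) (hfin : Module.Finite R (D 𝔪 (n+1) A)) :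
    ∃ x ∈ 𝔪, Function.Injective (x • (LinearMap.id : (A ⧸ Gam 𝔪 A) →ₗ[R] _)) ∧
      Module.Finite R (D 𝔪 (n+1) (A ⧸ Gam 𝔪 A)) ∧
      Module.supportDim R ((A ⧸ Gam 𝔪 A) ⧸
        LinearMap.range (x • (LinearMap.id : (A ⧸ Gam 𝔪 A) →ₗ[R] _))) = n ∧
      Module.Finite R (D 𝔪 n ((A ⧸ Gam 𝔪 A) ⧸
        LinearMap.range (x • (LinearMap.id : (A ⧸ Gam 𝔪 A) →ₗ[R] _)))) := by
  have hG0 := Gam_quot 𝔪 A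
  have hdim := dim_quot A n hA
  have hN : Module.Finite R (D 𝔪 (n+1) (A ⧸ Gam 𝔪 A)) := by
    obtain ⟨δ, -, h2, -⟩ := les 𝔪 (n+1) (Gam 𝔪 A).subtype (Gam 𝔪 A).mkQ
      (Submodule.subtype_injective _) (LinearMap.exact_subtype_mkQ _) (Submodule.mkQ_surjective _)
    have : Subsingleton (D 𝔪 (n+1+1) (Gam 𝔪 A)) := by
      obtain ⟨l, hl⟩ := Gam_unif 𝔪 A
      exact lemV_tors _ _ _ fun x hx => ⟨l, fun a => Subtype.ext (hl _ a.2 _ (Ideal.pow_mem_pow hx l))⟩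
    refine Module.Finite.of_surjective (Dm 𝔪 (n+1) (Gam 𝔪 A).mkQ) fun z => (h2 z).1 (Subsingleton.elim _ _)
  obtain ⟨x, hx, h1, h2, h3⟩ := NVaux n (A ⧸ Gam 𝔪 A) hG0 hdim hN
  exact ⟨x, hx, h1, hN, h2, h3⟩

theorem NV (n : ℕ) : ∀ (A : Type) [AddCommGroup A] [Module R A] [Module.Finite R A],
    Module.supportDim R A = (n + 1 : ℕ) → ¬ Module.Finite R (D 𝔪 (n+1) A) := by
  induction n with
  | zero =>
    intro A _ _ _ hA hfin
    obtain ⟨x, hx, hinj, h1, h2, h3⟩ := NVstep 0 A hA hfin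
    have hG0 := Gam_quot 𝔪 A
    obtain ⟨g, δ, -, hδ, hd⟩ := mul_les 𝔪 0 _ x hinj
    obtain ⟨g', δ', hg', -, -⟩ := mul_les 𝔪 1 _ x hinj
    have hr := tors_of_dim_zero _ h2
    obtain ⟨k, hk⟩ := Ideal.exists_pow_le_of_le_radical_of_fg hr (IsNoetherian.noetherian _)
    have hs1 := lemV_tors ((A ⧸ Gam 𝔪 A) ⧸
        LinearMap.range (x • (LinearMap.id : (A ⧸ Gam 𝔪 A) →ₗ[R] _))) 0 𝔪 (fun y hy =>
          ⟨k, fun a => Module.mem_annihilator.1 (hk (Ideal.pow_mem_pow hy k)) a⟩)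
    have hs2 : (⊤ : Submodule R (D 𝔪 1 (A ⧸ Gam 𝔪 A))) = ⊥ := by
      refine Submodule.eq_bot_of_le_smul_of_le_jacobson_bot 𝔪 _ h1.1 ?_ (IsLocalRing.maximalIdeal_le_jacobson _)
      intro z _
      obtain ⟨w, rfl⟩ := (hg' z).1 (Subsingleton.elim _ _)
      exact Submodule.smul_mem_smul hx trivial
    have hs2' : Subsingleton (D 𝔪 1 (A ⧸ Gam 𝔪 A)) :=
      subsingleton_of_forall_eq 0 fun z => (Submodule.mem_bot R).1 (hs2 ▸ Submodule.mem_top)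
    have hs3 : Subsingleton (D 𝔪 0 (A ⧸ Gam 𝔪 A)) := by
      obtain ⟨e⟩ := D0 (A ⧸ Gam 𝔪 A) 𝔪
      rw [hG0] at e
      exact e.toEquiv.subsingleton
    have hnt := (Module.supportDim_ne_bot_iff_nontrivial R _).1 (h2.trans_ne (by simp))
    obtain ⟨e⟩ := D0 ((A ⧸ Gam 𝔪 A) ⧸
        LinearMap.range (x • (LinearMap.id : (A ⧸ Gam 𝔪 A) →ₗ[R] _))) 𝔪
    obtain ⟨w, hw⟩ := exists_ne (0 : (A ⧸ Gam 𝔪 A) ⧸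
        LinearMap.range (x • (LinearMap.id : (A ⧸ Gam 𝔪 A) →ₗ[R] _)))
    have hwG : w ∈ Gam 𝔪 ((A ⧸ Gam 𝔪 A) ⧸
        LinearMap.range (x • (LinearMap.id : (A ⧸ Gam 𝔪 A) →ₗ[R] _))) :=
      mem_Gam.2 ⟨k, fun a ha => Module.mem_annihilator.1 (hk ha) w⟩
    obtain ⟨v, hv⟩ := e.surjective ⟨w, hwG⟩
    obtain ⟨u, rfl⟩ := (hδ v).1 (Subsingleton.elim _ _)
    rw [Subsingleton.elim u 0, map_zero, map_zero] at hv
    exact hw (congrArg Subtype.val hv).symm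
  | succ n ih =>
    intro A _ _ _ hA hfin
    obtain ⟨x, hx, hinj, h1, h2, h3⟩ := NVstep (n+1) A hA hfin
    exact ih _ h2 h3

theorem nonemp (A : Type) [AddCommGroup A] [Module R A] [Module.Finite R A] (r : ℕ)
    (hr : (r : WithBot ℕ∞) < Module.supportDim R A) :
    ∃ b : Ideal R, ∃ i, r ≤ i ∧ ¬ IsArtinian R (D b i A) := by
  by_contra hcon
  push Not at hcon
  have hlt : Module.supportDim R A < ⊤ :=
    (Module.supportDim_le_ringKrullDim R A).trans_lt ringKrullDim_lt_top
  obtain ⟨n, hn, hd⟩ : ∃ n : ℕ, r ≤ n ∧ Module.supportDim R A = (n + 1 : ℕ) := by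
    generalize Module.supportDim R A = t at hr hlt
    cases t with
    | bot => simp at hr
    | coe t =>
      cases t with
      | top => exact absurd hlt (lt_irrefl _)
      | coe t =>
        have h1 : r < t := by exact_mod_cast hr
        exact ⟨t - 1, by omega, by rw [Nat.sub_add_cancel (by omega)]; rfl⟩
  refine NV n A hd ?_
  have := lemV A n 𝔪 (fun b x hx y => by
    have := hcon b n hn
    exact artin_tors hx y)
  infer_instance
end TI
end S19


/-- Let `(R, m)` be a commutative noetherian local ring, `M` a finitely
generated `R`-module of Krull dimension `d`, and `r < d` a non-negative integer.  Let
`L^r(M)` be the set of ideals `b` of `R` such that `H^i_b(M)` is not artinian for some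
`i ≥ r`.  Then `L^r(M)` is non-empty, and for every element `q` of `L^r(M)` maximal with
respect to inclusion: (i) the Bass numbers `μ^j(H^i_q(M))`, i.e. the dimensions of
`Ext^j_R(R/m, H^i_q(M))` over `R/m`, are finite for all `j ≥ 0` and all `i ≥ r`; and
(ii) `q` is a prime ideal. -/
theorem statement19 {R : Type} [CommRing R] [IsNoetherianRing R] [IsLocalRing R]
    (M : ModuleCat R) [Module.Finite R M]
    (r : ℕ) (hr : (r : WithBot ℕ∞) < moduleDim R M)
    (L : Set (Ideal R))
    (hL : L = {b : Ideal R | ∃ i, r ≤ i ∧ ¬ IsArtinian R ((localCohomology b i).obj M)}) :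
    L.Nonempty ∧
    ∀ q ∈ L, (∀ b ∈ L, q ≤ b → b = q) →
      (∀ j i : ℕ, r ≤ i →
        Module.Finite R
          (((Ext R (ModuleCat R) j).obj
              (Opposite.op (ModuleCat.of R (R ⧸ IsLocalRing.maximalIdeal R)))).obj
            ((localCohomology q i).obj M))) ∧
      q.IsPrime := by
  have hart : ∀ b i, IsArtinian R ((localCohomology b i).obj M) ↔ IsArtinian R (S19.D b i M) := by
    intro b i
    obtain ⟨e⟩ := S19.lc_equiv b i M
    exact ⟨fun h => isArtinian_of_linearEquiv e, fun h => isArtinian_of_linearEquiv e.symm⟩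
  subst hL
  refine ⟨?_, fun q hq hmax => ?_⟩
  · obtain ⟨b, i, hi, h⟩ := S19.nonemp (R := R) M r hr
    exact ⟨b, i, hi, fun h' => h ((hart b i).1 h')⟩
  · have hq' : ∃ i, r ≤ i ∧ ¬ IsArtinian R (S19.D q i M) := by
      obtain ⟨i, hi, h⟩ := hq
      exact ⟨i, hi, fun h' => h ((hart q i).2 h')⟩
    have hmax' : ∀ b : Ideal R, q ≤ b → b ≠ q → ∀ i, r ≤ i → IsArtinian R (S19.D b i M) := by
      intro b hb hne i hi
      by_contra hcon
      exact hne (hmax b ⟨i, hi, fun h' => hcon ((hart b i).1 h')⟩ hb)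
    have hp := S19.q_prime M r q hq' hmax'
    refine ⟨fun j i hi => ?_, hp⟩
    have hf := S19.bass_q M r q hq' hp hmax' j i hi
    obtain ⟨e⟩ := S19.lc_equiv q i M
    let e1 : (localCohomology q i).obj M ≅ ModuleCat.of R (S19.D q i M) := e.toModuleIso
    let e2 := (((Ext R (ModuleCat R) j).obj
              (Opposite.op (ModuleCat.of R (R ⧸ IsLocalRing.maximalIdeal R)))).mapIso e1).toLinearEquiv
    exact Module.Finite.equiv (e2.trans (S19.extCmp (S19.kk R) (ModuleCat.of R (S19.D q i M)) j)).symm
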